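/- arXiv:0907.0343 — 2 statements merged into one kernel-verified Lean document; each statement's English description precedes it below -/
import Mathlib

section
/- Every finitely generated transcendental field extension F of an arbitrary field K is fully Hilbertian. -/
open Polynomial

/-- The Hilbert set of `f(X,Y) ∈ K[X][Y]` (with `Y` the outer variable). -/
def HilbertSet {K : Type} [Field K] (f : Polynomial (Polynomial K)) : Set K :=
  {a : K | Irreducible (f.map (Polynomial.evalRingHom a))}

/-- `K` is fully Hilbertian (equivalent characterization by absolutely irreducible
polynomials): for every absolutely irreducible `f(X,Y) ∈ K[X,Y]` separable in `Y` there
are `|K|` many `a ∈ H(f)` and roots `b_a` of `f(a,Y)` such that the fields `K(b_a)` are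
linearly disjoint over `K`. -/
def IsFullyHilbertian (K : Type) [Field K] : Prop :=
  ∀ f : Polynomial (Polynomial K),
    Irreducible (f.map (Polynomial.mapRingHom (algebraMap K (AlgebraicClosure K)))) →
    f.derivative ≠ 0 →
    ∃ (A : Set K) (b : A → AlgebraicClosure K),
      A ⊆ HilbertSet f ∧ Cardinal.mk A = Cardinal.mk K ∧
      (∀ a : A, Polynomial.aeval (b a) (f.map (Polynomial.evalRingHom (a : K))) = 0) ∧
      (∀ a : A,
        (IntermediateField.adjoin K {b a}).LinearDisjoint
          ↥(⨆ (a' : A) (_ : a' ≠ a), IntermediateField.adjoin K {b a'}))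

/-- A valuation on an overfield of `K[X]` lying over the place `X = ∞` of `K(X)`. -/
structure Valuation.IsAtInfinity (K : Type*) {M Γ : Type*} [Field K] [Field M] [Algebra K[X] M]
    [LinearOrderedCommGroupWithZero Γ] (w : Valuation M Γ) : Prop where
  const_le_one : ∀ x : K, w (algebraMap K[X] M (C x)) ≤ 1
  one_lt : 1 < w (algebraMap K[X] M X)

namespace Valuation.IsAtInfinity

variable {K M Γ : Type*} [Field K] [Field M] [Algebra K[X] M]
  [LinearOrderedCommGroupWithZero Γ] {w : Valuation M Γ}

theorem const_eq_one (hw : w.IsAtInfinity K) {x : K} (hx : x ≠ 0) :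
    w (algebraMap K[X] M (C x)) = 1 := by
  refine le_antisymm (hw.const_le_one x) ?_
  have h1 : w (algebraMap K[X] M (C x)) * w (algebraMap K[X] M (C x⁻¹)) = 1 := by
    rw [← map_mul, ← map_mul, ← C_mul, mul_inv_cancel₀ hx, map_one, map_one, map_one]
  calc (1 : Γ) = w (algebraMap K[X] M (C x)) * w (algebraMap K[X] M (C x⁻¹)) := h1.symm
    _ ≤ w (algebraMap K[X] M (C x)) * 1 := by gcongr; exact hw.const_le_one _
    _ = _ := mul_one _

theorem pos (hw : w.IsAtInfinity K) : 0 < w (algebraMap K[X] M X) :=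
  zero_lt_one.trans hw.one_lt

theorem ne_zero (hw : w.IsAtInfinity K) : w (algebraMap K[X] M X) ≠ 0 := hw.pos.ne'

theorem zpow_le_zpow (hw : w.IsAtInfinity K) {a b : ℤ} (h : a ≤ b) :
    w (algebraMap K[X] M X) ^ a ≤ w (algebraMap K[X] M X) ^ b :=
  zpow_le_zpow_right₀ hw.one_lt.le h

theorem zpow_lt_zpow (hw : w.IsAtInfinity K) {a b : ℤ} (h : a < b) :
    w (algebraMap K[X] M X) ^ a < w (algebraMap K[X] M X) ^ b :=
  zpow_lt_zpow_right₀ hw.one_lt h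

theorem zpow_le_one (hw : w.IsAtInfinity K) {a : ℤ} (h : a ≤ 0) :
    w (algebraMap K[X] M X) ^ a ≤ 1 := by
  simpa using hw.zpow_le_zpow h

theorem one_le_zpow (hw : w.IsAtInfinity K) {a : ℤ} (h : 0 ≤ a) :
    1 ≤ w (algebraMap K[X] M X) ^ a := by
  simpa using hw.zpow_le_zpow h

theorem algebraMap_le (hw : w.IsAtInfinity K) {p : K[X]} {d : ℕ} (hd : p.natDegree ≤ d) :
    w (algebraMap K[X] M p) ≤ w (algebraMap K[X] M X) ^ (d : ℤ) := by
  rw [p.as_sum_range, map_sum]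
  refine w.map_sum_le fun i hi => ?_
  rw [← C_mul_X_pow_eq_monomial, map_mul, map_mul, map_pow, map_pow]
  have hi' : i ≤ d := by rw [Finset.mem_range] at hi; omega
  calc _ ≤ 1 * w (algebraMap K[X] M X) ^ i := by gcongr; exact hw.const_le_one _
    _ ≤ _ := by rw [one_mul, ← zpow_natCast]; exact hw.zpow_le_zpow (by exact_mod_cast hi')

theorem algebraMap_eq (hw : w.IsAtInfinity K) {p : K[X]} (hp : p ≠ 0) :
    w (algebraMap K[X] M p) = w (algebraMap K[X] M X) ^ (p.natDegree : ℤ) := by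
  have hlead : w (algebraMap K[X] M (C p.leadingCoeff * X ^ p.natDegree)) =
      w (algebraMap K[X] M X) ^ (p.natDegree : ℤ) := by
    rw [map_mul, map_mul, hw.const_eq_one (leadingCoeff_ne_zero.2 hp), one_mul, map_pow, map_pow,
      zpow_natCast]
  rcases Nat.eq_zero_or_pos p.natDegree with h0 | hpos
  · rw [eq_C_of_natDegree_eq_zero h0] at hp ⊢
    simpa using hw.const_eq_one (x := p.coeff 0) (by simpa using hp)
  have herase : w (algebraMap K[X] M p.eraseLead) < w (algebraMap K[X] M X) ^ (p.natDegree : ℤ) :=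
    (hw.algebraMap_le (eraseLead_natDegree_le p)).trans_lt (hw.zpow_lt_zpow (by omega))
  conv_lhs => rw [← eraseLead_add_C_mul_X_pow p]
  rw [map_add, w.map_add_eq_of_lt_right (by rw [hlead]; exact herase), hlead]

theorem one_le_algebraMap (hw : w.IsAtInfinity K) {p : K[X]} (hp : p ≠ 0) :
    1 ≤ w (algebraMap K[X] M p) := by
  rw [hw.algebraMap_eq hp]
  exact hw.one_le_zpow (by positivity)

theorem comap (hw : w.IsAtInfinity K) (σ : M →ₐ[K[X]] M) :
    (w.comap (σ : M →+* M)).IsAtInfinity K where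
  const_le_one x := by simpa using hw.const_le_one x
  one_lt := by simpa using hw.one_lt

/-- Elements integral over `K[X]` are bounded by a power of `X`, uniformly in the place. -/
theorem exists_le_of_isIntegral (Γ : Type*) [LinearOrderedCommGroupWithZero Γ] {x : M}
    (hx : IsIntegral K[X] x) :
    ∃ r : ℕ, ∀ w : Valuation M Γ, w.IsAtInfinity K →
      w x ≤ w (algebraMap K[X] M X) ^ (r : ℤ) := by
  obtain ⟨p, hp, hpx⟩ := hx
  refine ⟨p.support.sup fun i => (p.coeff i).natDegree, fun w hw => ?_⟩
  set r := p.support.sup fun i => (p.coeff i).natDegree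
  by_contra! hlt
  have hcoeff (i : ℕ) : w (algebraMap K[X] M (p.coeff i)) ≤ w (algebraMap K[X] M X) ^ (r : ℤ) := by
    by_cases hi : i ∈ p.support
    · exact hw.algebraMap_le (Finset.le_sup (f := fun i => (p.coeff i).natDegree) hi)
    · rw [notMem_support_iff.1 hi, map_zero, map_zero]; exact zero_le
  have hone : 1 < w x := (hw.one_le_zpow (by positivity)).trans_lt hlt
  have hsum : x ^ p.natDegree +
      ∑ i ∈ Finset.range p.natDegree, algebraMap K[X] M (p.coeff i) * x ^ i = 0 := by
    rw [eval₂_eq_sum_range, Finset.sum_range_succ, hp.coeff_natDegree, map_one, one_mul,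
      add_comm] at hpx
    exact hpx
  have hlt' : w (∑ i ∈ Finset.range p.natDegree, algebraMap K[X] M (p.coeff i) * x ^ i) <
      w (x ^ p.natDegree) := by
    refine w.map_sum_lt' (by rw [map_pow]; exact pow_pos (zero_lt_one.trans hone) _) fun i hi => ?_
    rw [Finset.mem_range] at hi
    rw [map_mul, map_pow, map_pow]
    calc _ ≤ w (algebraMap K[X] M X) ^ (r : ℤ) * w x ^ i := by gcongr; exact hcoeff i
      _ < w x * w x ^ i := by
        gcongr
        exact pow_pos (zero_lt_one.trans hone) _
      _ = w x ^ (i + 1) := (pow_succ' _ _).symm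
      _ ≤ w x ^ p.natDegree := pow_le_pow_right₀ hone.le hi
  have := w.map_add_eq_of_lt_left hlt'
  rw [hsum, map_zero] at this
  rw [← this] at hlt'
  exact absurd hlt' not_lt_zero

/-- Algebraic elements are bounded by a power of `X`, uniformly in the place. -/
theorem exists_le [Algebra.IsAlgebraic K[X] M] [FaithfulSMul K[X] M] (Γ : Type*)
    [LinearOrderedCommGroupWithZero Γ] (x : M) :
    ∃ r : ℕ, ∀ w : Valuation M Γ, w.IsAtInfinity K →
      w x ≤ w (algebraMap K[X] M X) ^ (r : ℤ) := by
  obtain ⟨y, hy, hint⟩ := (Algebra.IsAlgebraic.isAlgebraic (R := K[X]) x).exists_integral_multiple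
  obtain ⟨r, hr⟩ := exists_le_of_isIntegral Γ hint
  refine ⟨r, fun w hw => ?_⟩
  calc w x = 1 * w x := (one_mul _).symm
    _ ≤ w (algebraMap K[X] M y) * w x := by gcongr; exact hw.one_le_algebraMap hy
    _ = w (y • x) := by rw [Algebra.smul_def, map_mul]
    _ ≤ _ := hr w hw

variable (K M) in
theorem exists_isAtInfinity [FaithfulSMul K[X] M] :
    ∃ v : ValuationSubring M, v.valuation.IsAtInfinity K := by
  set t : M := algebraMap K[X] M X
  have ht : t ≠ 0 := by
    exact (map_ne_zero_iff _ (FaithfulSMul.algebraMap_injective K[X] M)).2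
      (X_ne_zero (R := K))
  let φ : K[X] →+* M := eval₂RingHom ((algebraMap K[X] M).comp C) t⁻¹
  have hI : Ideal.span {(⟨t⁻¹, X, by simp [φ]⟩ : φ.range)} ≠ ⊤ := by
    rw [Ne, Ideal.span_singleton_eq_top]
    rintro hu
    obtain ⟨⟨_, q, rfl⟩, hq⟩ := hu.exists_right_inv
    have hq' : t⁻¹ * φ q = 1 := congrArg Subtype.val hq
    have hroot : eval₂ ((algebraMap K[X] M).comp C) t⁻¹ (X * q - 1) = 0 := by
      rw [eval₂_sub, eval₂_mul, eval₂_X, eval₂_one, sub_eq_zero]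
      exact hq'
    let : Invertible t⁻¹ := invertibleOfNonzero (inv_ne_zero ht)
    rw [← eval₂_reverse_eq_zero_iff, invOf_eq_inv, inv_inv, ← hom_eval₂, eval₂_C_X,
      map_eq_zero_iff _ (FaithfulSMul.algebraMap_injective K[X] M), reverse_eq_zero] at hroot
    simpa using congrArg (eval 0) hroot
  obtain ⟨B, hB, hB'⟩ := Ideal.image_subset_nonunits_valuationSubring _ hI
  refine ⟨B, ⟨fun x => ?_, ?_⟩⟩
  · rw [ValuationSubring.valuation_le_one_iff]
    exact hB ⟨C x, by simp [φ]⟩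
  · have : t⁻¹ ∈ B.nonunits := hB' ⟨_, Ideal.mem_span_singleton_self _, rfl⟩
    rw [ValuationSubring.mem_nonunits_iff, map_inv₀] at this
    exact (inv_lt_one₀ (zero_lt_iff.2 ((Valuation.ne_zero_iff _).2 ht))).1 this

end Valuation.IsAtInfinity

namespace Valuation.IsAtInfinity

theorem eq_zero_of_isIntegral {K E M Γ : Type*} [Field K] [Field E] [Field M] [Algebra K[X] E]
    [IsFractionRing K[X] E] [Algebra K[X] M] [Algebra E M] [IsScalarTower K[X] E M]
    [FaithfulSMul K[X] M] [IsAlgClosed M] [Algebra.IsAlgebraic E M]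
    [LinearOrderedCommGroupWithZero Γ] {v : Valuation M Γ}
    (hv : v.IsAtInfinity K) {x : M} (hx : IsIntegral K[X] x)
    (h : ∀ σ : M →ₐ[E] M, v (σ x) < 1) : x = 0 := by
  by_contra hx0
  have hmin := minpoly.isIntegrallyClosed_eq_field_fractions' (K := E) hx
  have hcoeff : (minpoly K[X] x).coeff 0 ≠ 0 := by
    intro h0
    have := minpoly.coeff_zero_ne_zero (A := E) hx.tower_top hx0
    rw [hmin, coeff_map, h0, map_zero] at this
    exact this rfl
  have hnormal : Normal E M :=
    { isAlgebraic := fun y => Algebra.IsAlgebraic.isAlgebraic y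
      splits' := fun y => IsAlgClosed.splits _ }
  set q := (minpoly K[X] x).map (algebraMap K[X] M)
  have hq : q = (minpoly E x).map (algebraMap E M) := by
    rw [hmin, map_map, ← IsScalarTower.algebraMap_eq]
  have hqm : q.Monic := (minpoly.monic hx).map _
  have hroots := (IsAlgClosed.splits q).coeff_zero_eq_prod_roots_of_monic hqm
  have hone := hv.one_le_algebraMap hcoeff
  rw [← coeff_map, hroots, map_mul, map_pow, v.map_neg, map_one, one_pow, one_mul,
    map_multiset_prod] at hone
  have hlt : ∀ y ∈ q.roots, v y < 1 := by
    intro y hy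
    rw [mem_roots hqm.ne_zero, hq, IsRoot, eval_map_algebraMap] at hy
    obtain ⟨σ, hσ⟩ := minpoly.exists_algEquiv_of_root' (K := E)
      (Algebra.IsAlgebraic.isAlgebraic x) hy
    rw [← hσ]
    exact h σ
  have hxq : x ∈ q.roots := by
    rw [mem_roots hqm.ne_zero, hq, IsRoot, eval_map_algebraMap, minpoly.aeval]
  obtain ⟨u, hu⟩ := Multiset.exists_cons_of_mem hxq
  rw [hu, Multiset.map_cons, Multiset.prod_cons] at hone
  refine absurd hone (not_le.2 ?_)
  have hu1 : (u.map v).prod ≤ 1 := by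
    refine Multiset.prod_induction (· ≤ 1) _ (fun _ _ => mul_le_one') le_rfl fun y hy => ?_
    obtain ⟨z, hz, rfl⟩ := Multiset.mem_map.1 hy
    exact (hlt z (hu ▸ Multiset.mem_cons_of_mem hz)).le
  calc v x * (u.map v).prod ≤ v x * 1 := by gcongr
    _ < 1 := by rw [mul_one]; exact hlt x hxq

end Valuation.IsAtInfinity

namespace Valuation

variable {M Γ ι : Type*} [Field M] [LinearOrderedCommGroupWithZero Γ] (w : Valuation M Γ)

private theorem coeff_X_sub_C_mul (y : M) (A : M[X]) (k : ℕ) {B R : Γ} (hR : 1 ≤ R)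
    (hy : w y ≤ R) (hA : ∀ k, w (A.coeff k) ≤ B) : w (((X - C y) * A).coeff k) ≤ R * B := by
  have hB : w (y * A.coeff k) ≤ R * B := by rw [map_mul]; exact mul_le_mul' hy (hA k)
  rw [sub_mul, coeff_sub, coeff_C_mul]
  cases k with
  | zero => simpa [w.map_neg] using hB
  | succ k =>
    rw [coeff_X_mul]
    exact w.map_sub_le ((hA k).trans (le_mul_of_one_le_left' hR)) hB

theorem coeff_prod_X_sub_C_le (s : Finset ι) (y : ι → M) {R : Γ} (hR : 1 ≤ R)
    (hy : ∀ i ∈ s, w (y i) ≤ R) (k : ℕ) :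
    w ((∏ i ∈ s, (X - C (y i))).coeff k) ≤ R ^ s.card := by
  classical
  induction s using Finset.induction_on generalizing k with
  | empty =>
    rw [Finset.prod_empty, coeff_one, Finset.card_empty, pow_zero]
    split_ifs <;> simp
  | insert a s ha ih =>
    rw [Finset.prod_insert ha, Finset.card_insert_of_notMem ha, pow_succ']
    exact w.coeff_X_sub_C_mul _ _ _ hR (hy a (Finset.mem_insert_self _ _))
      (ih fun i hi => hy i (Finset.mem_insert_of_mem hi))

theorem coeff_prod_X_sub_C_sub_le (s : Finset ι) (y y' : ι → M) {R δ : Γ} (hR : 1 ≤ R)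
    (hy : ∀ i ∈ s, w (y i) ≤ R) (hy' : ∀ i ∈ s, w (y' i) ≤ R) (hδ : ∀ i ∈ s, w (y i - y' i) ≤ δ)
    (k : ℕ) :
    w ((∏ i ∈ s, (X - C (y i))).coeff k - (∏ i ∈ s, (X - C (y' i))).coeff k) ≤
      δ * R ^ s.card := by
  classical
  induction s using Finset.induction_on generalizing k with
  | empty => simp
  | insert a s ha ih =>
    have hs {P : ι → Prop} (h : ∀ i ∈ insert a s, P i) : ∀ i ∈ s, P i :=
      fun i hi => h i (Finset.mem_insert_of_mem hi)
    have ha' := Finset.mem_insert_self a s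
    rw [Finset.prod_insert ha, Finset.prod_insert ha, Finset.card_insert_of_notMem ha, ← coeff_sub,
      show (X - C (y a)) * ∏ i ∈ s, (X - C (y i)) - (X - C (y' a)) * ∏ i ∈ s, (X - C (y' i)) =
        (X - C (y a)) * (∏ i ∈ s, (X - C (y i)) - ∏ i ∈ s, (X - C (y' i))) -
        C (y a - y' a) * ∏ i ∈ s, (X - C (y' i)) by rw [C_sub]; ring, coeff_sub]
    refine w.map_sub_le ?_ ?_
    · rw [pow_succ', mul_left_comm]
      refine w.coeff_X_sub_C_mul _ _ _ hR (hy a ha') fun k => ?_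
      rw [coeff_sub]
      exact ih (hs hy) (hs hy') (hs hδ) k
    · rw [coeff_C_mul, map_mul]
      refine mul_le_mul' (hδ a ha') ((w.coeff_prod_X_sub_C_le s y' hR (hs hy') k).trans ?_)
      exact pow_le_pow_right₀ hR (Nat.le_succ _)

variable [DecidableEq ι]

theorem dividedDifference_pow_le {s : Finset ι} {m : ℕ} (hs : s.card = m + 1) {z : ι → M}
    (hz : Set.InjOn z s) {ε : Γ} (hε : ε ≤ 1) (hzε : ∀ i ∈ s, w (z i) ≤ ε) {l : ℕ} (hl : m < l) :
    w (∑ i ∈ s, z i ^ l / ∏ j ∈ s.erase i, (z i - z j)) ≤ ε := by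
  set N : M[X] := ∏ i ∈ s, (X - C (z i))
  have hNm : N.Monic := monic_prod_of_monic _ _ fun i _ => monic_X_sub_C _
  have hNdeg : N.natDegree = m + 1 := by
    rw [natDegree_prod_of_monic _ _ fun i _ => monic_X_sub_C _]; simp [hs]
  have hN (k : ℕ) (hk : k < m + 1) : w (N.coeff k) ≤ ε := by
    have := w.coeff_prod_X_sub_C_sub_le s z 0 le_rfl (fun i hi => (hzε i hi).trans hε)
      (fun i _ => by simp) (δ := ε) (fun i hi => by simpa using hzε i hi) k
    simpa [coeff_X_pow, hs, hk.ne] using this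
  have hrec (i : ι) (hi : i ∈ s) : z i ^ (m + 1) =
      - ∑ k ∈ Finset.range (m + 1), N.coeff k * z i ^ k := by
    have h0 : N.eval (z i) = 0 := by
      rw [eval_prod]; exact Finset.prod_eq_zero hi (by simp)
    rw [eval_eq_sum_range, hNdeg, Finset.sum_range_succ] at h0
    rw [← hNdeg, hNm.coeff_natDegree, one_mul, hNdeg] at h0
    exact eq_neg_of_add_eq_zero_right h0
  have hsmall (l : ℕ) (hl : l ≤ m) :
      w (∑ i ∈ s, z i ^ l / ∏ j ∈ s.erase i, (z i - z j)) ≤ 1 := by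
    have := Lagrange.coeff_eq_sum hz (P := X ^ l) (by
      rw [degree_X_pow, hs]; exact_mod_cast Nat.lt_succ_of_le hl)
    simp only [eval_pow, eval_X] at this
    rw [← this, coeff_X_pow]
    split_ifs <;> simp
  induction l using Nat.strong_induction_on with
  | _ l ih =>
    obtain ⟨d, rfl⟩ := Nat.exists_eq_add_of_lt hl
    have heq : ∑ i ∈ s, z i ^ (m + d + 1) / ∏ j ∈ s.erase i, (z i - z j) =
        - ∑ k ∈ Finset.range (m + 1), N.coeff k *
          ∑ i ∈ s, z i ^ (k + d) / ∏ j ∈ s.erase i, (z i - z j) := by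
      simp_rw [Finset.mul_sum]
      rw [Finset.sum_comm, ← Finset.sum_neg_distrib]
      refine Finset.sum_congr rfl fun i hi => ?_
      rw [show m + d + 1 = m + 1 + d by ring, pow_add, hrec i hi, neg_mul, neg_div,
        Finset.sum_mul, Finset.sum_div]
      congr 1
      refine Finset.sum_congr rfl fun k _ => ?_
      rw [pow_add]; ring
    rw [heq, w.map_neg]
    refine w.map_sum_le fun k hk => ?_
    rw [Finset.mem_range] at hk
    rw [map_mul, ← mul_one ε]
    refine mul_le_mul' (hN k hk) ?_
    rcases le_or_gt (k + d) m with h | h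
    · exact hsmall _ h
    · exact (ih (k + d) (by omega) h).trans hε

theorem dividedDifference_sub_coeff_le {s : Finset ι} {m : ℕ} (hs : s.card = m + 1) {z : ι → M}
    (hz : Set.InjOn z s) {ε B : Γ} (hε : ε ≤ 1) (hzε : ∀ i ∈ s, w (z i) ≤ ε) (P : M[X])
    (hP : ∀ l, w (P.coeff l) ≤ B) :
    w (∑ i ∈ s, P.eval (z i) / ∏ j ∈ s.erase i, (z i - z j) - P.coeff m) ≤ B * ε := by
  have hsum : ∑ i ∈ s, P.eval (z i) / ∏ j ∈ s.erase i, (z i - z j) =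
      ∑ l ∈ Finset.range (P.natDegree + 1),
        P.coeff l * ∑ i ∈ s, z i ^ l / ∏ j ∈ s.erase i, (z i - z j) := by
    simp_rw [Finset.mul_sum, eval_eq_sum_range, Finset.sum_div]
    rw [Finset.sum_comm]
    simp_rw [mul_div_assoc]
  have hcoeff : P.coeff m = ∑ l ∈ Finset.range (P.natDegree + 1),
      P.coeff l * if l = m then 1 else 0 := by
    simp only [mul_ite, mul_one, mul_zero, Finset.sum_ite_eq', Finset.mem_range]
    split_ifs with h
    · rfl
    · exact coeff_eq_zero_of_natDegree_lt (by omega)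
  rw [hsum, hcoeff, ← Finset.sum_sub_distrib]
  refine w.map_sum_le fun l _ => ?_
  rw [← mul_sub, map_mul]
  refine mul_le_mul' (hP l) ?_
  rcases le_or_gt l m with h | h
  · have := Lagrange.coeff_eq_sum hz (P := X ^ l) (by
      rw [degree_X_pow, hs]; exact_mod_cast Nat.lt_succ_of_le h)
    simp only [eval_pow, eval_X] at this
    rw [← this, coeff_X_pow, hs, Nat.add_sub_cancel]
    simp [eq_comm]
  · rw [if_neg h.ne', sub_zero]
    exact w.dividedDifference_pow_le hs hz hε hzε h

end Valuation

theorem Polynomial.eq_C_leadingCoeff_mul_prod {A : Type*} [CommRing A] [IsDomain A] {g : A[X]}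
    (hg : g ≠ 0) {n : ℕ} (hn : g.natDegree ≤ n) {y : Fin n → A} (hy : Function.Injective y)
    (hroot : ∀ i, g.IsRoot (y i)) : g = C g.leadingCoeff * ∏ i, (X - C (y i)) := by
  have hle : (Finset.univ.val.map y) ≤ g.roots := by
    rw [Multiset.le_iff_subset ((Multiset.nodup_map_iff_of_injective hy).2 Finset.univ.nodup)]
    intro x hx
    obtain ⟨i, -, rfl⟩ := Multiset.mem_map.1 hx
    exact (mem_roots hg).2 (hroot i)
  have heq : Finset.univ.val.map y = g.roots :=
    Multiset.eq_of_le_of_card_le hle ((card_roots' g).trans (by simpa using hn))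
  have hcard : g.roots.card = g.natDegree :=
    le_antisymm (card_roots' g) (hn.trans (by simp [← heq]))
  conv_lhs => rw [← C_leadingCoeff_mul_prod_multiset_X_sub_C hcard]
  rw [← heq, Multiset.map_map]
  rfl

namespace Polynomial

variable {M : Type*} [Field M] {h : M[X][X]}

theorem exists_powerSeries_roots [IsAlgClosed M] {n : ℕ} (hn : h.natDegree = n)
    (hlead : h.leadingCoeff.eval 0 ≠ 0) (hsep : (h.map (evalRingHom 0)).Separable) :
    ∃ p : Fin n → PowerSeries M, Function.Injective (fun i => PowerSeries.constantCoeff (p i)) ∧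
      h.map coeToPowerSeries.ringHom =
        C (h.leadingCoeff : PowerSeries M) * ∏ i, (X - C (p i)) := by
  classical
  set h₀ := h.map (evalRingHom (0 : M))
  have hdeg₀ : h₀.natDegree = n := by
    rw [← hn]; exact natDegree_map_of_leadingCoeff_ne_zero _ hlead
  have hcard : h₀.roots.toFinset.card = n := by
    rw [Multiset.toFinset_card_of_nodup (nodup_roots hsep),
      ← (IsAlgClosed.splits h₀).natDegree_eq_card_roots, hdeg₀]
  let η : Fin n → M := fun i => (h₀.roots.toFinset.equivFinOfCardEq hcard).symm i
  have hη : Function.Injective η :=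
    Subtype.val_injective.comp (Equiv.injective _)
  have hh₀ : h₀ ≠ 0 := hsep.ne_zero
  have hηroot (i) : h₀.IsRoot (η i) := by
    have := ((h₀.roots.toFinset.equivFinOfCardEq hcard).symm i).2
    rw [Multiset.mem_toFinset, mem_roots hh₀] at this
    exact this
  set φ : M[X] →+* PowerSeries M := coeToPowerSeries.ringHom
  have hφ : Function.Injective φ := coe_injective M
  set H := h.map φ
  have hHlead : H.leadingCoeff = φ h.leadingCoeff := leadingCoeff_map_of_injective hφ _
  have hunit : IsUnit (φ h.leadingCoeff) := by
    rw [PowerSeries.isUnit_iff_constantCoeff, isUnit_iff_ne_zero]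
    rw [← coeff_zero_eq_eval_zero] at hlead
    simpa [φ] using hlead
  obtain ⟨u, hu⟩ := hunit
  set G := C (↑u⁻¹ : PowerSeries M) * H
  have hG : G.Monic := by
    rw [Monic, leadingCoeff_mul, leadingCoeff_C, hHlead, ← hu, Units.inv_mul]
  have hconst : (PowerSeries.constantCoeff (R := M)).comp φ = evalRingHom 0 := by
    ext <;> simp [φ]
  have hred : H.map PowerSeries.constantCoeff = h₀ := by rw [map_map, hconst]
  have hHroot (i) : ∃ p : PowerSeries M, H.IsRoot p ∧ PowerSeries.constantCoeff p = η i := by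
    have heval (Q : (PowerSeries M)[X]) : PowerSeries.constantCoeff (Q.eval (PowerSeries.C (η i)))
        = (Q.map PowerSeries.constantCoeff).eval (η i) := by
      rw [← eval_map_apply]; simp
    have hhens : HenselianRing (PowerSeries M) (Ideal.span {PowerSeries.X}) := inferInstance
    have hmem (q : PowerSeries M) :
        q ∈ Ideal.span {(PowerSeries.X : PowerSeries M)} ↔ PowerSeries.constantCoeff q = 0 := by
      rw [Ideal.mem_span_singleton, PowerSeries.X_dvd_iff]
    obtain ⟨p, hp, hp'⟩ := hhens.is_henselian G hG (PowerSeries.C (η i)) (by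
        rw [hmem, heval, Polynomial.map_mul, eval_mul, hred, (hηroot i).eq_zero, mul_zero])
      (by
        refine IsUnit.map _ ?_
        rw [PowerSeries.isUnit_iff_constantCoeff, isUnit_iff_ne_zero, heval, ← derivative_map,
          Polynomial.map_mul, hred, map_C, derivative_C_mul, eval_C_mul]
        refine mul_ne_zero ?_ (hsep.eval₂_derivative_ne_zero (RingHom.id M) (hηroot i))
        exact ((PowerSeries.isUnit_iff_constantCoeff).1 u⁻¹.isUnit).ne_zero)
    refine ⟨p, ?_, ?_⟩
    · rw [IsRoot, eval_mul, eval_C] at hp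
      exact (mul_eq_zero.1 hp).resolve_left u⁻¹.isUnit.ne_zero
    · rw [hmem, map_sub, sub_eq_zero] at hp'
      simpa using hp'
  choose p hp hpη using hHroot
  have hinj : Function.Injective (fun i => PowerSeries.constantCoeff (p i)) := by
    simpa only [hpη] using hη
  refine ⟨p, hinj, ?_⟩
  have := eq_C_leadingCoeff_mul_prod (g := H)
    ((Polynomial.map_ne_zero_iff hφ).2 (by rintro rfl; simp at hlead))
    (by rw [natDegree_map_eq_of_injective hφ, hn])
    (Function.Injective.of_comp (f := PowerSeries.constantCoeff) hinj) hp
  rw [this, hHlead]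
  rfl

/-- A nontrivial partial product of the power series factorization of an irreducible polynomial, or
its complementary product, has a coefficient that is not a polynomial of small degree. -/
theorem exists_coeff_ne_zero {n : ℕ} (hn : h.natDegree = n) (hirr : Irreducible h)
    {p : Fin n → PowerSeries M}
    (hp : h.map coeToPowerSeries.ringHom =
      C (h.leadingCoeff : PowerSeries M) * ∏ i, (X - C (p i)))
    (S : Finset (Fin n)) (hS : S.Nonempty) (hS' : Sᶜ.Nonempty) (d : ℕ) :
    ∃ S' : Finset (Fin n), (S' = S ∨ S' = Sᶜ) ∧ ∃ k m, d < m ∧ PowerSeries.coeff m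
      ((h.leadingCoeff : PowerSeries M) ^ n * (∏ i ∈ S', (X - C (p i))).coeff k) ≠ 0 := by
  classical
  by_contra! hcon
  set φ : M[X] →+* PowerSeries M := coeToPowerSeries.ringHom
  have hφ : Function.Injective φ := coe_injective M
  have hlead0 : h.leadingCoeff ≠ 0 := leadingCoeff_ne_zero.2 hirr.ne_zero
  have hlift (S' : Finset (Fin n)) (hS' : S' = S ∨ S' = Sᶜ) :
      ∃ A : M[X][X], A.map φ = C (φ h.leadingCoeff ^ n) * ∏ i ∈ S', (X - C (p i)) := by
    refine (mem_lifts _).1 ((lifts_iff_coeff_lifts _).2 fun k => ?_)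
    rw [coeff_C_mul]
    refine ⟨PowerSeries.trunc (d + 1) (φ h.leadingCoeff ^ n * (∏ i ∈ S', (X - C (p i))).coeff k),
      PowerSeries.ext fun m => ?_⟩
    rw [coeToPowerSeries.ringHom_apply, coeff_coe, PowerSeries.coeff_trunc]
    split_ifs with hm
    · rfl
    · exact (hcon S' hS' k m (by omega)).symm
  obtain ⟨A, hA⟩ := hlift S (.inl rfl)
  obtain ⟨B, hB⟩ := hlift Sᶜ (.inr rfl)
  have hdeg (S' : Finset (Fin n)) (A : M[X][X]) (hS' : S'ᶜ.Nonempty)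
      (hA : A.map φ = C (φ h.leadingCoeff ^ n) * ∏ i ∈ S', (X - C (p i))) : ¬ h ∣ A := by
    have hlead1 : φ h.leadingCoeff ^ n ≠ 0 := pow_ne_zero _ ((map_ne_zero_iff φ hφ).2 hlead0)
    have hA0 : A ≠ 0 := by
      rintro rfl
      rw [Polynomial.map_zero] at hA
      exact mul_ne_zero (C_ne_zero.2 hlead1)
        (monic_prod_of_monic _ _ fun i _ => monic_X_sub_C _).ne_zero hA.symm
    have hAdeg : A.natDegree = S'.card := by
      rw [← natDegree_map_eq_of_injective hφ, hA, natDegree_C_mul hlead1,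
        natDegree_prod_of_monic _ _ fun i _ => monic_X_sub_C _]
      simp
    intro hdvd
    have h1 := natDegree_le_of_dvd hdvd hA0
    have h2 := Finset.card_add_card_compl S'
    have h3 := hS'.card_pos
    rw [Fintype.card_fin] at h2
    omega
  have hmul : C h.leadingCoeff * (A * B) = C (h.leadingCoeff ^ (2 * n)) * h := by
    refine map_injective φ hφ ?_
    rw [Polynomial.map_mul, Polynomial.map_mul, Polynomial.map_mul, hA, hB, hp, map_C, map_C,
      ← Finset.prod_mul_prod_compl S]
    simp only [map_pow, φ, coeToPowerSeries.ringHom_apply]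
    ring
  have hprime := hirr.prime
  have hdvd : h ∣ C h.leadingCoeff * (A * B) := hmul ▸ dvd_mul_left _ _
  rcases hprime.dvd_or_dvd hdvd with h1 | h1
  · have h2 := natDegree_le_of_dvd h1 (C_ne_zero.2 hlead0)
    rw [natDegree_C, hn] at h2
    exact absurd hS.card_pos (by have := S.card_le_univ; rw [Fintype.card_fin] at this; omega)
  · rcases hprime.dvd_or_dvd h1 with h1 | h1
    · exact hdeg S A hS' hA h1
    · exact hdeg Sᶜ B (by simpa using hS) hB h1

end Polynomial

theorem Polynomial.X_pow_dvd_eval_trunc {R : Type*} [CommRing R] {h : R[X][X]} {p : PowerSeries R}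
    (hp : (h.map coeToPowerSeries.ringHom).IsRoot p) (m : ℕ) :
    (X : R[X]) ^ m ∣ h.eval (PowerSeries.trunc m p) := by
  rw [X_pow_dvd_iff]
  have h1 : (PowerSeries.X : PowerSeries R) ^ m ∣ (PowerSeries.trunc m p : PowerSeries R) - p := by
    rw [PowerSeries.X_pow_dvd_iff]
    intro d hd
    rw [map_sub, coeff_coe, PowerSeries.coeff_trunc, if_pos hd, sub_self]
  have h2 := h1.trans (sub_dvd_eval_sub _ _ (h.map coeToPowerSeries.ringHom))
  rw [hp.eq_zero, sub_zero, PowerSeries.X_pow_dvd_iff] at h2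
  intro d hd
  rw [← coeff_coe, ← coeToPowerSeries.ringHom_apply, ← eval_map_apply,
    coeToPowerSeries.ringHom_apply]
  exact h2 d hd

theorem Multiset.pow_card_lt_prod_of_lt {Γ : Type*} [LinearOrderedCommGroupWithZero Γ]
    {s : Multiset Γ} (hs : s ≠ 0) {a : Γ} (h : ∀ x ∈ s, a < x) : a ^ s.card < s.prod := by
  have key (s : Multiset Γ) : (∀ x ∈ s, a < x) → a ^ s.card ≤ s.prod ∧ 0 < s.prod := by
    induction s using Multiset.induction_on with
    | empty => simp
    | cons x s ih =>
      intro h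
      obtain ⟨h1, h2⟩ := ih fun y hy => h y (Multiset.mem_cons_of_mem hy)
      have hx := h x (Multiset.mem_cons_self x s)
      rw [Multiset.prod_cons, Multiset.card_cons, pow_succ']
      exact ⟨mul_le_mul' hx.le h1, mul_pos (lt_of_le_of_lt _root_.zero_le hx) h2⟩
  obtain ⟨x, hx⟩ := Multiset.exists_mem_of_ne_zero hs
  obtain ⟨t, rfl⟩ := Multiset.exists_cons_of_mem hx
  obtain ⟨h1, h2⟩ := key t fun y hy => h y (Multiset.mem_cons_of_mem hy)
  rw [Multiset.prod_cons, Multiset.card_cons, pow_succ']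
  exact (mul_le_mul_right h1 _).trans_lt (mul_lt_mul_of_pos_right (h x hx) h2)

namespace Valuation.IsAtInfinity

variable (K : Type*) {M : Type*} (Γ : Type*) [Field K] [Field M] [Algebra K[X] M]
  [FaithfulSMul K[X] M] [Algebra.IsAlgebraic K[X] M] [LinearOrderedCommGroupWithZero Γ]

theorem eventually_le (x : M) : ∀ᶠ r : ℕ in Filter.atTop, ∀ w : Valuation M Γ, w.IsAtInfinity K →
    w x ≤ w (algebraMap K[X] M X) ^ (r : ℤ) := by
  obtain ⟨r₀, hr₀⟩ := exists_le (K := K) Γ x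
  filter_upwards [Filter.eventually_ge_atTop r₀] with r hr w hw
  exact (hr₀ w hw).trans (hw.zpow_le_zpow (by exact_mod_cast hr))

theorem eventually_le_of_ne_zero {x : M} (hx : x ≠ 0) :
    ∀ᶠ r : ℕ in Filter.atTop, ∀ w : Valuation M Γ, w.IsAtInfinity K →
      w (algebraMap K[X] M X) ^ (-r : ℤ) ≤ w x := by
  filter_upwards [eventually_le K Γ x⁻¹] with r hr w hw
  have := hr w hw
  rw [map_inv₀] at this
  rw [zpow_neg]
  exact inv_le_of_inv_le₀ (w.pos_iff.2 hx) this

theorem eventually_coeff_le (q : M[X]) :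
    ∀ᶠ r : ℕ in Filter.atTop, ∀ w : Valuation M Γ, w.IsAtInfinity K → ∀ i,
      w (q.coeff i) ≤ w (algebraMap K[X] M X) ^ (r : ℤ) := by
  have h := (Filter.eventually_all_finset q.support).2 fun i _ => eventually_le K Γ (q.coeff i)
  filter_upwards [h] with r hr w hw i
  by_cases hi : i ∈ q.support
  · exact hr i hi w hw
  · rw [notMem_support_iff.1 hi, map_zero]
    exact zero_le

theorem eventually_eval_le (q : M[X]) :
    ∀ᶠ r : ℕ in Filter.atTop, ∀ w : Valuation M Γ, w.IsAtInfinity K → ∀ z, w z ≤ 1 →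
      w (q.eval z) ≤ w (algebraMap K[X] M X) ^ (r : ℤ) := by
  filter_upwards [eventually_coeff_le K Γ q] with r hr w hw z hz
  rw [eval_eq_sum_range]
  refine w.map_sum_le fun i _ => ?_
  rw [map_mul, map_pow]
  calc _ ≤ w (algebraMap K[X] M X) ^ (r : ℤ) * 1 := by
        gcongr
        · exact hr w hw i
        · exact pow_le_one' hz i
    _ = _ := mul_one _

theorem eventually_le_eval {q : M[X]} (hq : q.coeff 0 ≠ 0) :
    ∀ᶠ r : ℕ in Filter.atTop, ∀ w : Valuation M Γ, w.IsAtInfinity K → ∀ z,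
      w z ≤ w (algebraMap K[X] M X) ^ (-r : ℤ) →
      w (algebraMap K[X] M X) ^ (-r : ℤ) ≤ w (q.eval z) := by
  obtain ⟨a, ha, hb⟩ :=
    ((eventually_le_of_ne_zero K Γ hq).and (eventually_eval_le K Γ q.divX)).exists
  filter_upwards [Filter.eventually_gt_atTop (2 * a)] with r hr w hw z hz
  have hz1 : w z ≤ 1 := hz.trans (hw.zpow_le_one (by omega))
  have hlt : w (z * q.divX.eval z) < w (q.coeff 0) := by
    rw [map_mul]
    calc _ ≤ w (algebraMap K[X] M X) ^ (-r : ℤ) * w (algebraMap K[X] M X) ^ (a : ℤ) :=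
          mul_le_mul' hz (hb w hw z hz1)
      _ = w (algebraMap K[X] M X) ^ (-r + a : ℤ) := (zpow_add₀ hw.ne_zero _ _).symm
      _ < w (algebraMap K[X] M X) ^ (-a : ℤ) := hw.zpow_lt_zpow (by omega)
      _ ≤ _ := ha w hw
  have heq : q.eval z = z * q.divX.eval z + q.coeff 0 := by
    conv_lhs => rw [← X_mul_divX_add q]
    rw [eval_add, eval_mul, eval_X, eval_C]
  rw [heq, w.map_add_eq_of_lt_right hlt]
  exact (hw.zpow_le_zpow (by omega)).trans (ha w hw)

/-- Near `Z = 0`, uniformly in the place at infinity, the roots of `h(z, Y)` are approximated by the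
values of the truncations of the power series roots of `h`. -/
theorem eventually_exists_roots [IsAlgClosed M] {h : M[X][X]} {n N : ℕ} (hn : h.natDegree = n)
    (hlead : h.leadingCoeff.eval 0 ≠ 0) (hN : 0 < N) {P : Fin n → M[X]}
    (hP : Function.Injective fun i => (P i).coeff 0)
    (hdvd : ∀ i, (X : M[X]) ^ (n * N) ∣ h.eval (P i)) :
    ∀ᶠ r : ℕ in Filter.atTop, ∀ w : Valuation M Γ, w.IsAtInfinity K → ∀ z,
      w z ≤ w (algebraMap K[X] M X) ^ (-r : ℤ) → h.leadingCoeff.eval z ≠ 0 ∧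
      ∃ y : Fin n → M, Function.Injective y ∧
        h.map (evalRingHom z) = C (h.leadingCoeff.eval z) * ∏ i, (X - C (y i)) ∧
        (∀ i, w (y i) ≤ w (algebraMap K[X] M X) ^ (r : ℤ)) ∧
        (∀ i, w ((P i).eval z) ≤ w (algebraMap K[X] M X) ^ (r : ℤ)) ∧
        ∀ i, w (y i - (P i).eval z) ≤ w z ^ N * w (algebraMap K[X] M X) ^ (r : ℤ) := by
  choose Q hQ using hdvd
  have h1 := Filter.eventually_all.2 fun i => eventually_eval_le K Γ (Q i)
  have h2 := Filter.eventually_all.2 fun i => eventually_eval_le K Γ (P i)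
  have h3 := Filter.eventually_all.2 fun i => Filter.eventually_all.2 fun j =>
    show ∀ᶠ r : ℕ in Filter.atTop, i ≠ j → ∀ w : Valuation M Γ, w.IsAtInfinity K → ∀ z,
      w z ≤ w (algebraMap K[X] M X) ^ (-r : ℤ) →
      w (algebraMap K[X] M X) ^ (-r : ℤ) ≤ w ((P i - P j).eval z) by
    rw [Filter.eventually_imp_distrib_left]
    exact fun hij => eventually_le_eval K Γ (by
      rw [coeff_sub, sub_ne_zero]; exact fun h => hij (hP h))
  have h4 := eventually_le_eval K Γ (q := h.leadingCoeff) (by rwa [coeff_zero_eq_eval_zero])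
  obtain ⟨a, h1, h2, h3, h4⟩ := (h1.and (h2.and (h3.and h4))).exists
  filter_upwards [Filter.eventually_gt_atTop (3 * a)] with r hr w hw z hz
  set T := w (algebraMap K[X] M X)
  have hTa : (0 : Γ) < T ^ (-a : ℤ) := zpow_pos hw.pos _
  have hza : w z ≤ T ^ (-a : ℤ) := hz.trans (hw.zpow_le_zpow (by omega))
  have hz1 : w z ≤ 1 := hz.trans (hw.zpow_le_one (by omega))
  have hleadz := h4 w hw z hza
  have hlead0 : h.leadingCoeff.eval z ≠ 0 := fun h0 => by
    rw [h0, map_zero] at hleadz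
    exact hTa.not_ge hleadz
  refine ⟨hlead0, ?_⟩
  set g := h.map (evalRingHom z)
  have hglead : g.leadingCoeff = h.leadingCoeff.eval z :=
    leadingCoeff_map_of_leadingCoeff_ne_zero _ hlead0
  have hgdeg : g.natDegree = n := by
    rw [← hn]; exact natDegree_map_of_leadingCoeff_ne_zero _ hlead0
  have hcard : g.roots.card = n := by
    rw [← hgdeg]; exact ((IsAlgClosed.splits g).natDegree_eq_card_roots).symm
  have hroot (i : Fin n) : ∃ y ∈ g.roots, w (y - (P i).eval z) ≤ w z ^ N * T ^ (2 * a : ℤ) := by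
    by_contra! hcon
    have hev : g.eval ((P i).eval z) = z ^ (n * N) * (Q i).eval z := by
      have : g.eval ((P i).eval z) = (h.eval (P i)).eval z := by
        rw [← coe_evalRingHom z, ← eval_map_apply]
      rw [this, hQ, eval_mul, eval_pow, eval_X]
    have hfac : w (g.eval ((P i).eval z)) =
        w g.leadingCoeff * (g.roots.map fun y => w (y - (P i).eval z)).prod := by
      conv_lhs => rw [← C_leadingCoeff_mul_prod_multiset_X_sub_C (hcard.trans hgdeg.symm)]
      rw [eval_mul, eval_C, eval_multiset_prod, map_mul, map_multiset_prod, Multiset.map_map,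
        Multiset.map_map]
      congr 3
      ext y
      simp [w.map_sub_swap]
    have hlt := Multiset.pow_card_lt_prod_of_lt (a := w z ^ N * T ^ (2 * a : ℤ))
      (s := g.roots.map fun y => w (y - (P i).eval z)) (by
        rw [← Multiset.card_pos, Multiset.card_map, hcard]; exact i.pos) (fun x hx => by
          obtain ⟨y, hy, rfl⟩ := Multiset.mem_map.1 hx
          exact hcon y hy)
    rw [Multiset.card_map, hcard] at hlt
    have hn1 : (1 : ℤ) ≤ n := by exact_mod_cast i.pos
    have hlt2 : T ^ (-a : ℤ) * (w z ^ N * T ^ (2 * a : ℤ)) ^ n <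
        w z ^ (n * N) * T ^ (a : ℤ) := by
      calc _ < T ^ (-a : ℤ) * (g.roots.map fun y => w (y - (P i).eval z)).prod :=
            mul_lt_mul_of_pos_left hlt hTa
        _ ≤ w g.leadingCoeff * (g.roots.map fun y => w (y - (P i).eval z)).prod := by
            rw [hglead]; gcongr
        _ = w z ^ (n * N) * w ((Q i).eval z) := by rw [← hfac, hev, map_mul, map_pow]
        _ ≤ _ := by gcongr; exact h1 i w hw z hz1
    refine hlt2.not_ge ?_
    calc _ ≤ w z ^ (n * N) * T ^ (-a + 2 * a * n : ℤ) := by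
          exact mul_le_mul' le_rfl (hw.zpow_le_zpow (by nlinarith))
      _ = _ := by
          rw [zpow_add₀ hw.ne_zero, mul_pow, zpow_mul, zpow_natCast _ n, mul_comm n N, pow_mul]
          exact mul_left_comm _ _ _
  choose y hy hyP using hroot
  have hsmall : w z ^ N * T ^ (2 * a : ℤ) < T ^ (-a : ℤ) := by
    calc _ ≤ w z ^ 1 * T ^ (2 * a : ℤ) := by
          gcongr ?_ * _
          exact pow_le_pow_right_of_le_one' hz1 hN
      _ ≤ T ^ (-r : ℤ) * T ^ (2 * a : ℤ) := by rw [pow_one]; gcongr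
      _ = T ^ (-r + 2 * a : ℤ) := (zpow_add₀ hw.ne_zero _ _).symm
      _ < _ := hw.zpow_lt_zpow (by omega)
  have hyinj : Function.Injective y := by
    intro i j hij
    by_contra hne
    have h5 := h3 i j hne w hw z hza
    refine h5.not_gt (lt_of_le_of_lt ?_ hsmall)
    have : (P i - P j).eval z = (y j - (P j).eval z) - (y i - (P i).eval z) := by
      rw [eval_sub, hij]; ring
    rw [this]
    exact w.map_sub_le (hyP j) (hyP i)
  have hPr (i : Fin n) : w ((P i).eval z) ≤ T ^ (r : ℤ) :=
    (h2 i w hw z hz1).trans (hw.zpow_le_zpow (by omega))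
  refine ⟨y, hyinj, ?_, fun i => ?_, hPr, fun i => ?_⟩
  · rw [← hglead]
    refine eq_C_leadingCoeff_mul_prod ?_ hgdeg.le hyinj fun i => isRoot_of_mem_roots (hy i)
    intro h0
    rw [h0] at hglead
    exact hlead0 (by simpa using hglead.symm)
  · rw [← sub_add_cancel (y i) ((P i).eval z)]
    refine w.map_add_le ((hyP i).trans (hsmall.le.trans (hw.zpow_le_zpow (by omega)))) (hPr i)
  · refine (hyP i).trans ?_
    exact mul_le_mul' le_rfl (hw.zpow_le_zpow (by omega))

end Valuation.IsAtInfinity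

namespace Polynomial

theorem eq_prod_of_mul_eq_prod {M ι : Type*} [Field M] [Fintype ι] [DecidableEq ι] {y : ι → M}
    (hy : Function.Injective y) {g g' : M[X]} (hg : g.Monic) (hg' : g'.Monic)
    (h : g * g' = ∏ i, (X - C (y i))) :
    ∃ S : Finset ι, g = ∏ i ∈ S, (X - C (y i)) ∧ g' = ∏ i ∈ Sᶜ, (X - C (y i)) := by
  classical
  have hroot (i : ι) : g.IsRoot (y i) ∨ g'.IsRoot (y i) := by
    rw [← root_mul, h, IsRoot, eval_prod]
    exact Finset.prod_eq_zero (Finset.mem_univ i) (by simp)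
  let S : Finset ι := {i | g.IsRoot (y i)}
  have hdvd (S : Finset ι) (q : M[X]) (hq : ∀ i ∈ S, q.IsRoot (y i)) :
      ∏ i ∈ S, (X - C (y i)) ∣ q :=
    Finset.prod_dvd_of_coprime ((pairwise_coprime_X_sub_C hy).set_pairwise _)
      fun i hi => dvd_iff_isRoot.2 (hq i hi)
  obtain ⟨a, ha⟩ := hdvd S g fun i hi => (Finset.mem_filter.1 hi).2
  obtain ⟨b, hb⟩ := hdvd Sᶜ g' fun i hi => (hroot i).resolve_left fun h =>
    Finset.mem_compl.1 hi (Finset.mem_filter.2 ⟨Finset.mem_univ i, h⟩)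
  have hmon (S : Finset ι) : (∏ i ∈ S, (X - C (y i))).Monic :=
    monic_prod_of_monic _ _ fun i _ => monic_X_sub_C _
  have hab : a * b = 1 := by
    rw [← Finset.prod_mul_prod_compl S, ha, hb] at h
    refine mul_left_cancel₀ ((hmon S).mul (hmon Sᶜ)).ne_zero ?_
    linear_combination h
  have ha1 : a.Monic := (hmon S).of_mul_monic_left (ha ▸ hg)
  have hb1 : b.Monic := (hmon Sᶜ).of_mul_monic_left (hb ▸ hg')
  refine ⟨S, ?_, ?_⟩
  · rw [ha, ha1.eq_one_of_isUnit (.of_mul_eq_one _ hab), mul_one]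
  · rw [hb, hb1.eq_one_of_isUnit (.of_mul_eq_one _ ((mul_comm b a).trans hab)), mul_one]

theorem isIntegral_pow_mul_coeff_prod {R M ι : Type*} [CommRing R] [CommRing M] [Algebra R M]
    {a : M} (ha : IsIntegral R a) (S : Finset ι) (y : ι → M)
    (hy : ∀ i ∈ S, IsIntegral R (a * y i)) (k : ℕ) :
    IsIntegral R (a ^ S.card * (∏ i ∈ S, (X - C (y i))).coeff k) := by
  classical
  induction S using Finset.induction_on generalizing k with
  | empty =>
    rw [Finset.prod_empty, coeff_one, Finset.card_empty, pow_zero, one_mul]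
    split_ifs
    exacts [isIntegral_one, isIntegral_zero]
  | insert j S hj ih =>
    have ih := ih fun i hi => hy i (Finset.mem_insert_of_mem hi)
    have hj' := hy j (Finset.mem_insert_self j S)
    rw [Finset.prod_insert hj, Finset.card_insert_of_notMem hj, sub_mul, coeff_sub, coeff_C_mul,
      pow_succ', mul_sub]
    refine .sub ?_ ?_
    · rcases k with - | k
      · rw [coeff_X_mul_zero, mul_zero]; exact isIntegral_zero
      · rw [coeff_X_mul, mul_assoc]; exact ha.mul (ih k)
    · rw [mul_mul_mul_comm]; exact hj'.mul (ih k)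

/-- Clearing denominators in a partial product of the linear factors of `h(1 / c, Y)`. -/
theorem isIntegral_coeff_prod_of_map_eval {R M : Type*} [CommRing R] [Field M] [Algebra R M]
    {h : M[X][X]} {n D : ℕ} (hD : ∀ j, (h.coeff j).natDegree ≤ D) {d c : M}
    (hc : IsIntegral R c) (hd0 : d ≠ 0) (hc0 : c ≠ 0)
    (hdh : ∀ j i, IsIntegral R (d * (h.coeff j).coeff i))
    {y : Fin n → M} (hlead : h.leadingCoeff.eval c⁻¹ ≠ 0)
    (hy : h.map (evalRingHom c⁻¹) = C (h.leadingCoeff.eval c⁻¹) * ∏ i, (X - C (y i)))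
    (S : Finset (Fin n)) (k N : ℕ) (hN : D * n ≤ N) :
    IsIntegral R (d ^ n * c ^ N * (h.leadingCoeff.eval c⁻¹ ^ n *
      (∏ i ∈ S, (X - C (y i))).coeff k)) := by
  have hint (j : ℕ) : IsIntegral R (d * c ^ D * (h.coeff j).eval c⁻¹) := by
    rw [eval_eq_sum_range' (Nat.lt_succ_of_le (hD j)), Finset.mul_sum]
    refine IsIntegral.sum _ fun i hi => ?_
    have hiD : i ≤ D := Nat.lt_succ_iff.1 (Finset.mem_range.1 hi)
    have : d * c ^ D * ((h.coeff j).coeff i * c⁻¹ ^ i) =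
        d * (h.coeff j).coeff i * c ^ (D - i) := by
      rw [← Nat.sub_add_cancel hiD, pow_add, Nat.add_sub_cancel, inv_pow]
      field_simp
    rw [this]
    exact (hdh j i).mul (hc.pow _)
  set l := d * c ^ D * h.leadingCoeff.eval c⁻¹ with hl
  have hl0 : l ≠ 0 := mul_ne_zero (mul_ne_zero hd0 (pow_ne_zero _ hc0)) hlead
  have hlint : IsIntegral R l := hint _
  have hroot (i : Fin n) : IsIntegral R (l * y i) := by
    let q : M[X] := C (d * c ^ D) * h.map (evalRingHom c⁻¹)
    have hq (j : ℕ) : IsIntegral R (q.coeff j) := by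
      rw [coeff_C_mul, coeff_map, coe_evalRingHom]
      exact hint j
    have hqlead : q.leadingCoeff = l := by
      rw [leadingCoeff_C_mul_of_isUnit, leadingCoeff_map_of_leadingCoeff_ne_zero _ hlead]
      · rfl
      · exact (mul_ne_zero hd0 (pow_ne_zero _ hc0)).isUnit
    have hqroot : q.eval (y i) = 0 := by
      rw [eval_mul, hy, eval_mul, eval_prod,
        Finset.prod_eq_zero (Finset.mem_univ i) (by simp), mul_zero, mul_zero]
    let A := integralClosure R M
    obtain ⟨Q, hQ⟩ : ∃ Q : A[X], Q.map (algebraMap A M) = q :=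
      (mem_lifts q).1 ((lifts_iff_coeff_lifts q).2 fun j => ⟨⟨q.coeff j, hq j⟩, rfl⟩)
    have hinj : Function.Injective (algebraMap A M) := Subtype.val_injective
    have := isIntegral_leadingCoeff_smul Q (y i) (by rw [aeval_def, ← eval_map, hQ, hqroot])
    rw [Algebra.smul_def, ← leadingCoeff_map_of_injective hinj, hQ, hqlead] at this
    exact isIntegral_trans _ this
  have key := isIntegral_pow_mul_coeff_prod hlint S y (fun i _ => hroot i) k
  have hcard : S.card ≤ n := by simpa using S.card_le_univ
  have : d ^ n * c ^ N * (h.leadingCoeff.eval c⁻¹ ^ n * (∏ i ∈ S, (X - C (y i))).coeff k) =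
      c ^ (N - D * n) * (l ^ (n - S.card) * (l ^ S.card * (∏ i ∈ S, (X - C (y i))).coeff k)) := by
    rw [← mul_assoc (l ^ (n - S.card)), ← pow_add, Nat.sub_add_cancel hcard, hl, mul_pow, mul_pow,
      ← pow_mul]
    conv_lhs => rw [← Nat.sub_add_cancel hN, pow_add]
    ring
  rw [this]
  exact (hc.pow _).mul ((hlint.pow _).mul key)

end Polynomial

namespace Valuation.IsAtInfinity

variable {K M Γ : Type*} [Field K] [Field M] [Algebra K[X] M]
  [LinearOrderedCommGroupWithZero Γ] {w : Valuation M Γ}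

theorem coeff_prod_sub_eval_le (hw : w.IsAtInfinity K) {n N r : ℕ} {l : M[X]}
    {P : Fin n → M[X]} {z : M} {y : Fin n → M}
    (hl : w (l.eval z) ≤ w (algebraMap K[X] M X) ^ (r : ℤ))
    (hy : ∀ i, w (y i) ≤ w (algebraMap K[X] M X) ^ (r : ℤ))
    (hP : ∀ i, w ((P i).eval z) ≤ w (algebraMap K[X] M X) ^ (r : ℤ))
    (hyP : ∀ i, w (y i - (P i).eval z) ≤ w z ^ N * w (algebraMap K[X] M X) ^ (r : ℤ))
    (S : Finset (Fin n)) (k : ℕ) :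
    w (l.eval z ^ n * (∏ i ∈ S, (X - C (y i))).coeff k -
      (l ^ n * (∏ i ∈ S, (X - C (P i))).coeff k).eval z) ≤
      w z ^ N * w (algebraMap K[X] M X) ^ (((2 * n + 1) * r : ℕ) : ℤ) := by
  set T := w (algebraMap K[X] M X)
  have hT : (1 : Γ) ≤ T ^ (r : ℤ) := hw.one_le_zpow (by positivity)
  have heval : ((∏ i ∈ S, (X - C (P i))).coeff k).eval z =
      (∏ i ∈ S, (X - C ((P i).eval z))).coeff k := by
    rw [← coe_evalRingHom, ← coeff_map, Polynomial.map_prod]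
    simp
  rw [eval_mul, eval_pow, heval, ← mul_sub, map_mul, map_pow]
  have h1 := w.coeff_prod_X_sub_C_sub_le S y (fun i => (P i).eval z) hT (fun i _ => hy i)
    (fun i _ => hP i) (fun i _ => hyP i) k
  have hcard : S.card ≤ n := by simpa using S.card_le_univ
  calc _ ≤ (T ^ (r : ℤ)) ^ n * (w z ^ N * T ^ (r : ℤ) * (T ^ (r : ℤ)) ^ n) := by
        gcongr
        refine h1.trans ?_
        gcongr
    _ = w z ^ N * ((T ^ (r : ℤ)) ^ n * (T ^ (r : ℤ) * (T ^ (r : ℤ)) ^ n)) := by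
        rw [mul_assoc, mul_left_comm]
    _ = _ := by
        rw [← pow_succ', ← pow_add, zpow_natCast, zpow_natCast, ← pow_mul]
        congr 2
        ring

end Valuation.IsAtInfinity

section

variable {M ι : Type*} [Field M] [DecidableEq ι]

theorem sum_div_prod_inv_sub_inv {s : Finset ι} {m : ℕ} (hs : s.card = m + 2) {c : ι → M}
    (hc : ∀ i ∈ s, c i ≠ 0) (I : ι → M) :
    ∑ i ∈ s, I i / ∏ j ∈ s.erase i, ((c i)⁻¹ - (c j)⁻¹) =
      (∏ i ∈ s, c i) * ∑ i ∈ s, c i ^ m * I i / ∏ j ∈ s.erase i, (c j - c i) := by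
  rw [Finset.mul_sum]
  refine Finset.sum_congr rfl fun i hi => ?_
  have hi0 := hc i hi
  have h1 : ∏ j ∈ s.erase i, ((c i)⁻¹ - (c j)⁻¹) =
      (∏ j ∈ s.erase i, (c j - c i)) / (c i ^ (m + 1) * ∏ j ∈ s.erase i, c j) := by
    have hcard : (s.erase i).card = m + 1 := by rw [Finset.card_erase_of_mem hi, hs]; rfl
    rw [← hcard, ← Finset.prod_const, ← Finset.prod_mul_distrib, ← Finset.prod_div_distrib]
    refine Finset.prod_congr rfl fun j hj => ?_
    have hj0 := hc j (Finset.mem_of_mem_erase hj)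
    rw [inv_sub_inv hi0 hj0]
  rw [h1, ← Finset.mul_prod_erase s c hi, div_div_eq_mul_div, pow_succ]
  ring

theorem isIntegral_mul_sum_div_prod_sub {R : Type*} [CommRing R] [Algebra R M] {s : Finset ι}
    {c : ι → M} (hc : ∀ i ∈ s, IsIntegral R (c i)) (hcinj : Set.InjOn c s) {I : ι → M} {d : M}
    (hI : ∀ i ∈ s, IsIntegral R (d * I i)) :
    IsIntegral R (d * (∏ i ∈ s, ∏ j ∈ s.erase i, (c j - c i)) *
      ∑ i ∈ s, I i / ∏ j ∈ s.erase i, (c j - c i)) := by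
  rw [Finset.mul_sum]
  refine IsIntegral.sum _ fun i hi => ?_
  have hne : ∏ j ∈ s.erase i, (c j - c i) ≠ 0 := Finset.prod_ne_zero_iff.2 fun j hj =>
    sub_ne_zero.2 fun h => (Finset.ne_of_mem_erase hj)
      (hcinj (Finset.mem_of_mem_erase hj) hi h)
  rw [← Finset.mul_prod_erase s _ hi]
  have : d * ((∏ j ∈ s.erase i, (c j - c i)) *
      ∏ x ∈ s.erase i, ∏ j ∈ s.erase x, (c j - c x)) * (I i / ∏ j ∈ s.erase i, (c j - c i)) =
      d * I i * ∏ x ∈ s.erase i, ∏ j ∈ s.erase x, (c j - c x) := by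
    field_simp
  rw [this]
  exact (hI i hi).mul (IsIntegral.prod _ fun x hx => IsIntegral.prod _ fun j hj =>
    (hc j (Finset.mem_of_mem_erase hj)).sub (hc x (Finset.mem_of_mem_erase hx)))

end

namespace Valuation.IsAtInfinity

variable {K M Γ : Type*} [Field K] [Field M] [Algebra K[X] M]
  [LinearOrderedCommGroupWithZero Γ] {w : Valuation M Γ}

variable {H e : ℕ} {s : Finset K[X]}

theorem map_X_pow_add (he : e < H) (hs : ∀ b ∈ s, b.natDegree ≤ e)
    (hw : w.IsAtInfinity K) {b : K[X]} (hb : b ∈ s) :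
    w (algebraMap K[X] M (X ^ H + b)) = w (algebraMap K[X] M X) ^ (H : ℤ) := by
  have hlt : b.natDegree < (X ^ H : K[X]).natDegree := by
    rw [natDegree_X_pow]; exact (hs b hb).trans_lt he
  have hdeg : (X ^ H + b : K[X]).natDegree = H := by
    rw [natDegree_add_eq_left_of_natDegree_lt hlt, natDegree_X_pow]
  rw [hw.algebraMap_eq (fun h0 => ?_), hdeg]
  rw [h0, natDegree_zero] at hdeg
  omega

theorem one_le_map_sub_le (hs : ∀ b ∈ s, b.natDegree ≤ e) (hw : w.IsAtInfinity K)
    {b b' : K[X]} (hb : b ∈ s) (hb' : b' ∈ s) (hne : b ≠ b') :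
    1 ≤ w (algebraMap K[X] M (X ^ H + b) - algebraMap K[X] M (X ^ H + b')) ∧
    w (algebraMap K[X] M (X ^ H + b) - algebraMap K[X] M (X ^ H + b')) ≤
      w (algebraMap K[X] M X) ^ (e : ℤ) := by
  rw [← _root_.map_sub, add_sub_add_left_eq_sub]
  exact ⟨hw.one_le_algebraMap (sub_ne_zero.2 hne),
    hw.algebraMap_le
    ((natDegree_sub_le_of_le (hs b hb) (hs b' hb')).trans (max_self e).le)⟩

variable [DecidableEq K[X]] {m r : ℕ} {I : K[X] → M} {G : M[X]}

theorem map_dividedDifference_sub_coeff_le (he : e < H)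
    (hs : ∀ b ∈ s, b.natDegree ≤ e) (hcard : s.card = m + 2) (hw : w.IsAtInfinity K)
    (hG : ∀ l, w (G.coeff l) ≤ w (algebraMap K[X] M X) ^ (r : ℤ))
    (hI : ∀ b ∈ s, w (I b - G.eval (algebraMap K[X] M (X ^ H + b))⁻¹) ≤
      w (algebraMap K[X] M (X ^ H + b))⁻¹ ^ (2 * m + 3) * w (algebraMap K[X] M X) ^ (r : ℤ)) :
    w (∑ b ∈ s, I b / ∏ b' ∈ s.erase b,
        ((algebraMap K[X] M (X ^ H + b))⁻¹ - (algebraMap K[X] M (X ^ H + b'))⁻¹) -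
      G.coeff (m + 1)) ≤ w (algebraMap K[X] M X) ^ (r - H : ℤ) := by
  set T := w (algebraMap K[X] M X)
  set c : K[X] → M := fun b => algebraMap K[X] M (X ^ H + b)
  have hc (b : K[X]) (hb : b ∈ s) : w (c b) = T ^ (H : ℤ) := map_X_pow_add he hs hw hb
  have hc0 (b : K[X]) (hb : b ∈ s) : c b ≠ 0 := by
    rw [← w.ne_zero_iff, hc b hb]; exact zpow_ne_zero _ hw.ne_zero
  have hz (b : K[X]) (hb : b ∈ s) : w (c b)⁻¹ = T ^ (-H : ℤ) := by
    rw [map_inv₀, hc b hb, zpow_neg]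
  have hsub (b : K[X]) (hb : b ∈ s) (b' : K[X]) (hb' : b' ∈ s) (hne : b ≠ b') :
      T ^ (-(2 * H) : ℤ) ≤ w ((c b)⁻¹ - (c b')⁻¹) := by
    rw [inv_sub_inv (hc0 b hb) (hc0 b' hb'), map_div₀, map_mul, hc b hb, hc b' hb',
      ← zpow_add₀ hw.ne_zero, zpow_neg, ← two_mul, inv_eq_one_div]
    exact div_le_div_of_nonneg_right (one_le_map_sub_le hs hw hb' hb hne.symm).1
      zero_le
  have hzinj : Set.InjOn (fun b => (c b)⁻¹) s := by
    intro b hb b' hb' hbb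
    by_contra hne
    have := hsub b hb b' hb' hne
    simp only at hbb
    rw [hbb, sub_self, map_zero] at this
    exact (zpow_pos hw.pos _).not_ge this
  have h1 := w.dividedDifference_sub_coeff_le (m := m + 1) hcard hzinj (ε := T ^ (-H : ℤ))
    (hw.zpow_le_one (by omega)) (fun b hb => (hz b hb).le) G hG
  rw [← zpow_add₀ hw.ne_zero] at h1
  have h2 : w (∑ b ∈ s, (I b - G.eval (c b)⁻¹) / ∏ b' ∈ s.erase b, ((c b)⁻¹ - (c b')⁻¹)) ≤
      T ^ (r - H : ℤ) := by
    refine w.map_sum_le fun b hb => ?_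
    rw [map_div₀, map_prod]
    have h3 : T ^ (-(2 * H) * (m + 1) : ℤ) ≤
        ∏ b' ∈ s.erase b, w ((c b)⁻¹ - (c b')⁻¹) := by
      have hcard' : (s.erase b).card = m + 1 := by rw [Finset.card_erase_of_mem hb, hcard]; rfl
      rw [show (m + 1 : ℤ) = ((m + 1 : ℕ) : ℤ) by push_cast; rfl, ← hcard', zpow_mul, zpow_natCast,
        ← Finset.prod_const]
      exact Finset.prod_le_prod' fun b' hb' => hsub b hb b' (Finset.mem_of_mem_erase hb')
        (Finset.ne_of_mem_erase hb').symm
    refine (div_le_div₀ zero_le (hI b hb) (zpow_pos hw.pos _) h3).trans ?_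
    rw [hz b hb, ← zpow_natCast, ← zpow_mul, ← zpow_add₀ hw.ne_zero, ← zpow_sub₀ hw.ne_zero]
    refine hw.zpow_le_zpow ?_
    push_cast
    nlinarith
  have heq : ∑ b ∈ s, I b / ∏ b' ∈ s.erase b, ((c b)⁻¹ - (c b')⁻¹) - G.coeff (m + 1) =
      ∑ b ∈ s, (I b - G.eval (c b)⁻¹) / ∏ b' ∈ s.erase b, ((c b)⁻¹ - (c b')⁻¹) +
      (∑ b ∈ s, G.eval (c b)⁻¹ / ∏ b' ∈ s.erase b, ((c b)⁻¹ - (c b')⁻¹) - G.coeff (m + 1)) := by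
    simp_rw [sub_div, Finset.sum_sub_distrib]
    ring
  rw [heq]
  exact w.map_add_le h2 (h1.trans (hw.zpow_le_zpow (by omega)))

theorem map_mul_sum_div_prod_sub_lt_one (he : e < H)
    (hs : ∀ b ∈ s, b.natDegree ≤ e) (hcard : s.card = m + 2) (hw : w.IsAtInfinity K) {d : M}
    (hd : w d ≤ w (algebraMap K[X] M X) ^ (r : ℤ)) (hH : 2 * r + e * (m + 2) < H)
    (hG : ∀ l, w (G.coeff l) ≤ w (algebraMap K[X] M X) ^ (r : ℤ))
    (hI : ∀ b ∈ s, w (I b - G.eval (algebraMap K[X] M (X ^ H + b))⁻¹) ≤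
      w (algebraMap K[X] M (X ^ H + b))⁻¹ ^ (2 * m + 3) * w (algebraMap K[X] M X) ^ (r : ℤ)) :
    w (d * (∏ b ∈ s, ∏ b' ∈ s.erase b,
        (algebraMap K[X] M (X ^ H + b') - algebraMap K[X] M (X ^ H + b))) *
      ∑ b ∈ s, algebraMap K[X] M (X ^ H + b) ^ m * I b / ∏ b' ∈ s.erase b,
        (algebraMap K[X] M (X ^ H + b') - algebraMap K[X] M (X ^ H + b))) < 1 := by
  have hD := map_dividedDifference_sub_coeff_le he hs hcard hw hG hI
  set T := w (algebraMap K[X] M X)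
  set c : K[X] → M := fun b => algebraMap K[X] M (X ^ H + b)
  have hc (b : K[X]) (hb : b ∈ s) : w (c b) = T ^ (H : ℤ) := map_X_pow_add he hs hw hb
  have hc0 (b : K[X]) (hb : b ∈ s) : c b ≠ 0 := by
    rw [← w.ne_zero_iff, hc b hb]; exact zpow_ne_zero _ hw.ne_zero
  have hD' := w.map_add_le (hD.trans (hw.zpow_le_zpow (show (r - H : ℤ) ≤ r by omega)))
    (hG (m + 1))
  rw [sub_add_cancel, sum_div_prod_inv_sub_inv hcard hc0, map_mul, map_prod,
    Finset.prod_congr rfl hc, Finset.prod_const, hcard] at hD'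
  have hV : w (∏ b ∈ s, ∏ b' ∈ s.erase b, (c b' - c b)) ≤
      ((T ^ (e : ℤ)) ^ (m + 1)) ^ (m + 2) := by
    rw [map_prod, ← hcard, ← Finset.prod_const]
    refine Finset.prod_le_prod' fun b hb => ?_
    have hcard' : (s.erase b).card = m + 1 := by rw [Finset.card_erase_of_mem hb, hcard]; rfl
    rw [map_prod, ← hcard', ← Finset.prod_const]
    exact Finset.prod_le_prod' fun b' hb' => (one_le_map_sub_le hs hw
      (Finset.mem_of_mem_erase hb') hb (Finset.ne_of_mem_erase hb')).2
  set W := ∑ b ∈ s, c b ^ m * I b / ∏ b' ∈ s.erase b, (c b' - c b)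
  have hpos : 0 < (T ^ (H : ℤ)) ^ (m + 2) := pow_pos (zpow_pos hw.pos _) _
  rw [map_mul, map_mul]
  refine lt_of_mul_lt_mul_left (a := (T ^ (H : ℤ)) ^ (m + 2)) ?_ zero_le
  change (T ^ (H : ℤ)) ^ (m + 2) * (w d * w (∏ b ∈ s, ∏ b' ∈ s.erase b, (c b' - c b)) * w W) < _
  calc _ = w d * w (∏ b ∈ s, ∏ b' ∈ s.erase b, (c b' - c b)) *
        ((T ^ (H : ℤ)) ^ (m + 2) * w W) := mul_left_comm _ _ _
    _ ≤ T ^ (r : ℤ) * ((T ^ (e : ℤ)) ^ (m + 1)) ^ (m + 2) * T ^ (r : ℤ) := by gcongr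
    _ = T ^ ((r + e * (m + 1) * (m + 2) + r : ℕ) : ℤ) := by
        simp only [zpow_natCast]
        rw [← pow_mul, ← pow_mul, ← pow_add, ← pow_add, mul_assoc]
    _ < T ^ ((H * (m + 2) : ℕ) : ℤ) := hw.zpow_lt_zpow (by
        have : r + e * (m + 1) * (m + 2) + r < H * (m + 2) := by nlinarith
        exact_mod_cast this)
    _ = _ := by
        simp only [zpow_natCast]
        rw [← pow_mul, mul_one]

theorem sum_div_prod_sub_ne_zero (he : e < H)
    (hs : ∀ b ∈ s, b.natDegree ≤ e) (hcard : s.card = m + 2) (hw : w.IsAtInfinity K)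
    (hH : 2 * r < H)
    (hG : ∀ l, w (G.coeff l) ≤ w (algebraMap K[X] M X) ^ (r : ℤ))
    (hG0 : w (algebraMap K[X] M X) ^ (-r : ℤ) ≤ w (G.coeff (m + 1)))
    (hI : ∀ b ∈ s, w (I b - G.eval (algebraMap K[X] M (X ^ H + b))⁻¹) ≤
      w (algebraMap K[X] M (X ^ H + b))⁻¹ ^ (2 * m + 3) * w (algebraMap K[X] M X) ^ (r : ℤ)) :
    ∑ b ∈ s, algebraMap K[X] M (X ^ H + b) ^ m * I b / ∏ b' ∈ s.erase b,
      (algebraMap K[X] M (X ^ H + b') - algebraMap K[X] M (X ^ H + b)) ≠ 0 := by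
  have hD := map_dividedDifference_sub_coeff_le he hs hcard hw hG hI
  set c : K[X] → M := fun b => algebraMap K[X] M (X ^ H + b)
  have hc0 (b : K[X]) (hb : b ∈ s) : c b ≠ 0 := by
    rw [← w.ne_zero_iff, show w (c b) = _ from map_X_pow_add he hs hw hb]
    exact zpow_ne_zero _ hw.ne_zero
  intro h0
  rw [sum_div_prod_inv_sub_inv hcard hc0, h0, mul_zero, zero_sub, map_neg] at hD
  exact (hG0.trans hD).not_gt (hw.zpow_lt_zpow (by omega))

end Valuation.IsAtInfinity

theorem Polynomial.coeff_mul_coeff_prod_trunc {R ι : Type*} [CommRing R] (B : ℕ) (a : R[X])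
    (p : ι → PowerSeries R) (S : Finset ι) (k : ℕ) {l : ℕ} (hl : l < B) :
    (a * (∏ i ∈ S, (X - C (PowerSeries.trunc B (p i)))).coeff k).coeff l =
      PowerSeries.coeff l ((a : PowerSeries R) * (∏ i ∈ S, (X - C (p i))).coeff k) := by
  set φ : R[X] →+* PowerSeries R := coeToPowerSeries.ringHom
  let q := Ideal.Quotient.mk (Ideal.span {(PowerSeries.X : PowerSeries R) ^ B})
  have htrunc (i : ι) : q (φ (PowerSeries.trunc B (p i))) = q (p i) := by
    rw [Ideal.Quotient.eq, Ideal.mem_span_singleton, PowerSeries.X_pow_dvd_iff]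
    intro d hd
    rw [map_sub, coeToPowerSeries.ringHom_apply, coeff_coe, PowerSeries.coeff_trunc, if_pos hd,
      sub_self]
  have h1 : q (φ (a * (∏ i ∈ S, (X - C (PowerSeries.trunc B (p i)))).coeff k)) =
      q (φ a * (∏ i ∈ S, (X - C (p i))).coeff k) := by
    rw [map_mul, map_mul, map_mul, ← coeff_map, ← coeff_map, ← coeff_map]
    simp only [Polynomial.map_prod, Polynomial.map_sub, map_X, map_C, htrunc]
  rw [Ideal.Quotient.eq, Ideal.mem_span_singleton, PowerSeries.X_pow_dvd_iff] at h1
  have h2 := h1 l hl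
  rw [map_sub, sub_eq_zero, coeToPowerSeries.ringHom_apply, coeff_coe] at h2
  exact h2

/-- `h(z, Y)` is a constant times a product of two nonconstant monic polynomials over `L`. -/
def Polynomial.FactorsAt {M : Type*} [Field M] (h : M[X][X]) (L : Set M) (z : M) : Prop :=
  ∃ g g' : M[X], g.Monic ∧ g'.Monic ∧ 0 < g.natDegree ∧ 0 < g'.natDegree ∧
    (∀ k, g.coeff k ∈ L) ∧ (∀ k, g'.coeff k ∈ L) ∧
    h.map (evalRingHom z) = C (h.leadingCoeff.eval z) * (g * g')

theorem IntermediateField.exists_algHom_extension {E M : Type*} [Field E] [Field M] [Algebra E M]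
    [IsAlgClosed M] [Algebra.IsAlgebraic E M] (L : IntermediateField E M) (τ : L →ₐ[E] M) :
    ∃ σ : M →ₐ[E] M, ∀ x : L, σ x = τ x := by
  have : Normal E M :=
    { isAlgebraic := fun y => Algebra.IsAlgebraic.isAlgebraic y
      splits' := fun y => IsAlgClosed.splits _ }
  exact ⟨τ.liftNormal M, fun x => τ.liftNormal_commutes M x⟩

namespace Valuation.IsAtInfinity

variable {K E M Γ : Type*} [Field K] [Field E] [Field M] [Algebra K[X] E] [IsFractionRing K[X] E]
  [Algebra K[X] M] [Algebra E M] [IsScalarTower K[X] E M] [FaithfulSMul K[X] M] [IsAlgClosed M]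
  [Algebra.IsAlgebraic K[X] M] [LinearOrderedCommGroupWithZero Γ] {v : Valuation M Γ}

/-- An irreducible `h(Z, Y)` factors at `Z = 1 / (X ^ H + b)` over a finite extension of `K(X)`
only for boundedly many polynomials `b` of degree at most `e`, with a bound independent of `e`. -/
theorem exists_card_le_of_factorsAt (hv : v.IsAtInfinity K) {h : M[X][X]} (hirr : Irreducible h)
    (hlead : h.leadingCoeff.eval 0 ≠ 0) (hsep : (h.map (evalRingHom 0)).Separable) :
    ∃ H : ℕ → ℕ, (∀ e, e < H e) ∧ ∀ L : IntermediateField E M, FiniteDimensional E L →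
      (∀ i j, (h.coeff i).coeff j ∈ L) → ∃ B : ℕ, ∀ e, ∀ s : Finset K[X],
        (∀ b ∈ s, b.natDegree ≤ e ∧
          h.FactorsAt L (algebraMap K[X] M (X ^ H e + b))⁻¹) → s.card ≤ B := by
  classical
  have : Algebra.IsAlgebraic E M :=
    (IsFractionRing.comap_isAlgebraic_iff (A := K[X]) (K := E) (C := M)).1 inferInstance
  obtain ⟨n, hn⟩ : ∃ n, h.natDegree = n := ⟨_, rfl⟩
  obtain ⟨p, hpinj, hp⟩ := exists_powerSeries_roots hn hlead hsep
  obtain ⟨D, hD⟩ : ∃ D, ∀ j, (h.coeff j).natDegree ≤ D := by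
    refine ⟨h.support.sup fun j => (h.coeff j).natDegree, fun j => ?_⟩
    by_cases hj : j ∈ h.support
    · exact Finset.le_sup (f := fun j => (h.coeff j).natDegree) hj
    · rw [notMem_support_iff.1 hj, natDegree_zero]; exact Nat.zero_le _
  have key (S : Finset (Fin n)) : ∃ (S' : Finset (Fin n)) (k m : ℕ), S.Nonempty → Sᶜ.Nonempty →
      (S' = S ∨ S' = Sᶜ) ∧ D * n ≤ m ∧ PowerSeries.coeff (m + 1)
        ((h.leadingCoeff : PowerSeries M) ^ n * (∏ i ∈ S', (X - C (p i))).coeff k) ≠ 0 := by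
    by_cases hS : S.Nonempty
    · by_cases hSc : Sᶜ.Nonempty
      · obtain ⟨S', hS', k, m, hm, hne⟩ := exists_coeff_ne_zero hn hirr hp S hS hSc (D * n)
        obtain ⟨m, rfl⟩ : ∃ m', m = m' + 1 := ⟨m - 1, by omega⟩
        exact ⟨S', k, m, fun _ _ => ⟨hS', by omega, hne⟩⟩
      · exact ⟨S, 0, 0, fun _ h => absurd h hSc⟩
    · exact ⟨S, 0, 0, fun h => absurd h hS⟩
  choose S' k m hS' using key
  set mm := Finset.univ.sup m
  have hmm (S : Finset (Fin n)) : m S ≤ mm := Finset.le_sup (Finset.mem_univ S)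
  set N := 2 * mm + 3 with hN
  set P : Fin n → M[X] := fun i => PowerSeries.trunc (n * N) (p i) with hP
  have hPinj : Function.Injective fun i => (P i).coeff 0 := by
    intro i j hij
    refine hpinj ?_
    have hpos : 0 < n * N := Nat.mul_pos i.pos (by omega)
    simpa [hP, PowerSeries.coeff_trunc, hpos] using hij
  have hdvd (i : Fin n) : (X : M[X]) ^ (n * N) ∣ h.eval (P i) := by
    refine X_pow_dvd_eval_trunc ?_ _
    rw [hp, IsRoot, eval_mul, eval_prod, Finset.prod_eq_zero (Finset.mem_univ i) (by simp),
      mul_zero]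
  set G : Finset (Fin n) → ℕ → M[X] := fun S k =>
    h.leadingCoeff ^ n * (∏ i ∈ S, (X - C (P i))).coeff k with hG
  have hGne (S : Finset (Fin n)) (h1 : S.Nonempty) (h2 : Sᶜ.Nonempty) :
      (G (S' S) (k S)).coeff (m S + 1) ≠ 0 := by
    have hn : 0 < n := h1.choose.pos
    have := hmm S
    rw [hG, coeff_mul_coeff_prod_trunc (n * N) (h.leadingCoeff ^ n) p (S' S) (k S)
      (lt_of_lt_of_le (by omega) (Nat.le_mul_of_pos_left N hn)), coe_pow]
    exact (hS' S h1 h2).2.2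
  obtain ⟨d, hd0, hd⟩ : ∃ d : K[X], d ≠ 0 ∧ ∀ j i,
      IsIntegral K[X] (algebraMap K[X] M d * (h.coeff j).coeff i) := by
    obtain ⟨d, hd0, hd⟩ := Algebra.IsAlgebraic.exists_integral_multiples (R := K[X])
      (h.support.biUnion fun j => (h.coeff j).coeffs)
    refine ⟨d, hd0, fun j i => ?_⟩
    rw [← Algebra.smul_def]
    by_cases hj : (h.coeff j).coeff i = 0
    · rw [hj, smul_zero]; exact isIntegral_zero
    · refine hd _ (Finset.mem_biUnion.2 ⟨j, ?_, coeff_mem_coeffs hj⟩)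
      rw [mem_support_iff]
      rintro h0
      exact hj (by rw [h0, coeff_zero])
  have hd0' : algebraMap K[X] M d ≠ 0 :=
    (map_ne_zero_iff _ (FaithfulSMul.algebraMap_injective K[X] M)).2 hd0
  have e1 := eventually_exists_roots K Γ hn hlead (N := N) (by omega) hPinj hdvd
  have e2 := eventually_eval_le K Γ h.leadingCoeff
  have e3 := Filter.eventually_all.2 fun S => Filter.eventually_all.2 fun S₁ =>
    eventually_coeff_le K Γ (G S (k S₁))
  have e4 := Filter.eventually_all.2 fun S => show ∀ᶠ r : ℕ in Filter.atTop,
      S.Nonempty ∧ Sᶜ.Nonempty → ∀ w : Valuation M Γ, w.IsAtInfinity K →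
        w (algebraMap K[X] M X) ^ (-r : ℤ) ≤ w ((G (S' S) (k S)).coeff (m S + 1)) by
    rw [Filter.eventually_imp_distrib_left]
    exact fun hS => eventually_le_of_ne_zero K Γ (hGne S hS.1 hS.2)
  have e5 := eventually_le K Γ (algebraMap K[X] M d ^ n)
  obtain ⟨r, e1, e2, e3, e4, e5⟩ := (e1.and (e2.and (e3.and (e4.and e5)))).exists
  set R := (2 * n + 1) * r with hR
  have hrR : r ≤ R := Nat.le_mul_of_pos_left r (by omega)
  refine ⟨fun e => 2 * R + e * (mm + 2) + 1, fun e => by nlinarith, fun L hL hLh => ?_⟩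
  have hlift := L.exists_algHom_extension
  choose lift hlift using hlift
  let w : (L →ₐ[E] M) → Valuation M Γ := fun τ => v.comap (lift τ : M →+* M)
  have hw (τ : L →ₐ[E] M) : (w τ).IsAtInfinity K := hv.comap ((lift τ).restrictScalars K[X])
  refine ⟨Fintype.card ((L →ₐ[E] M) → Finset (Fin n)) * (mm + 1), fun e s hs => ?_⟩
  set H := 2 * R + e * (mm + 2) + 1 with hH
  have heH : e < H := by rw [hH]; nlinarith
  have hrH : r ≤ H := by rw [hH]; nlinarith
  have hdeg : ∀ b ∈ s, b.natDegree ≤ e := fun b hb => (hs b hb).1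
  choose! g g' hg hg' hgpos hgpos' hgL hgL' hfac using fun b hb => (hs b hb).2
  set c : K[X] → M := fun b => algebraMap K[X] M (X ^ H + b) with hc
  have hcw (τ : L →ₐ[E] M) (b : K[X]) (hb : b ∈ s) :
      w τ (c b)⁻¹ = w τ (algebraMap K[X] M X) ^ (-H : ℤ) := by
    rw [map_inv₀, zpow_neg, map_X_pow_add heH hdeg (hw τ) hb]
  have hpat (τ : L →ₐ[E] M) (b : K[X]) (hb : b ∈ s) : ∃ (y : Fin n → M) (S : Finset (Fin n)),
      h.leadingCoeff.eval (c b)⁻¹ ≠ 0 ∧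
      h.map (evalRingHom (c b)⁻¹) = C (h.leadingCoeff.eval (c b)⁻¹) * ∏ i, (X - C (y i)) ∧
      (g b = ∏ i ∈ S, (X - C (y i)) ∧ g' b = ∏ i ∈ Sᶜ, (X - C (y i))) ∧
      ∀ (S : Finset (Fin n)) (k : ℕ),
        w τ (h.leadingCoeff.eval (c b)⁻¹ ^ n * (∏ i ∈ S, (X - C (y i))).coeff k -
          (G S k).eval (c b)⁻¹) ≤ w τ (c b)⁻¹ ^ N * w τ (algebraMap K[X] M X) ^ (R : ℤ) := by
    have hz : w τ (c b)⁻¹ ≤ w τ (algebraMap K[X] M X) ^ (-r : ℤ) := by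
      rw [hcw τ b hb]; exact (hw τ).zpow_le_zpow (by omega)
    obtain ⟨hl, y, hyinj, hy, hyr, hPr, hyP⟩ := e1 (w τ) (hw τ) _ hz
    obtain ⟨S, hS⟩ := eq_prod_of_mul_eq_prod hyinj (hg b hb) (hg' b hb)
      (mul_left_cancel₀ (C_ne_zero.2 hl) ((hfac b hb).symm.trans hy))
    exact ⟨y, S, hl, hy, hS, coeff_prod_sub_eval_le (hw τ)
      (e2 (w τ) (hw τ) _ (hz.trans ((hw τ).zpow_le_one (by omega)))) hyr hPr hyP⟩
  choose! y pat hl hy hgy hap using hpat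
  by_contra! hlt
  obtain ⟨Q, -, hQ⟩ := Finset.exists_lt_card_fiber_of_mul_lt_card_of_maps_to
    (s := s) (t := Finset.univ) (f := fun b τ => pat τ b) (n := mm + 1)
    (fun b _ => Finset.mem_univ _) (by simpa using hlt)
  set S₁ := Q L.val with hS₁
  have hm₁ := hmm S₁
  obtain ⟨t, hts, htcard⟩ := Finset.exists_subset_card_eq
    (show m S₁ + 2 ≤ _ from (Nat.succ_le_succ (Nat.succ_le_succ hm₁)).trans hQ)
  have htS (b : K[X]) (hb : b ∈ t) : b ∈ s := (Finset.mem_filter.1 (hts hb)).1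
  have htQ (b : K[X]) (hb : b ∈ t) (τ : L →ₐ[E] M) : pat τ b = Q τ :=
    congrFun (Finset.mem_filter.1 (hts hb)).2 τ
  have htdeg : ∀ b ∈ t, b.natDegree ≤ e := fun b hb => hdeg b (htS b hb)
  have hne : S₁.Nonempty ∧ S₁ᶜ.Nonempty := by
    obtain ⟨b, hb⟩ : t.Nonempty := by rw [← Finset.card_pos]; omega
    have h1 := hgy L.val b (htS b hb)
    rw [htQ b hb] at h1
    constructor
    · rw [Finset.nonempty_iff_ne_empty]
      intro h0
      have := hgpos b (htS b hb)
      rw [h1.1, ← hS₁, h0, Finset.prod_empty, natDegree_one] at this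
      exact this.false
    · rw [Finset.nonempty_iff_ne_empty]
      intro h0
      have := hgpos' b (htS b hb)
      rw [h1.2, ← hS₁, h0, Finset.prod_empty, natDegree_one] at this
      exact this.false
  obtain ⟨gg, S₂, hggL, hggy, hS₂⟩ : ∃ (gg : K[X] → M[X]) (S₂ : (L →ₐ[E] M) → Finset (Fin n)),
      (∀ b ∈ t, ∀ k, (gg b).coeff k ∈ L) ∧
      (∀ τ, ∀ b ∈ t, gg b = ∏ i ∈ S₂ τ, (X - C (y τ b i))) ∧ S₂ L.val = S' S₁ := by
    rcases (hS' S₁ hne.1 hne.2).1 with h1 | h1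
    · refine ⟨g, Q, fun b hb => hgL b (htS b hb), fun τ b hb => ?_, h1.symm⟩
      rw [← htQ b hb]
      exact (hgy τ b (htS b hb)).1
    · refine ⟨g', fun τ => (Q τ)ᶜ, fun b hb => hgL' b (htS b hb), fun τ b hb => ?_, h1.symm⟩
      simp only [← htQ b hb τ]
      exact (hgy τ b (htS b hb)).2
  set I : K[X] → M := fun b => h.leadingCoeff.eval (c b)⁻¹ ^ n * (gg b).coeff (k S₁) with hI
  have hcL (b : K[X]) : c b ∈ L := by
    rw [hc]
    simp only
    rw [IsScalarTower.algebraMap_apply K[X] E M]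
    exact L.algebraMap_mem _
  have hIL (b : K[X]) (hb : b ∈ t) : I b ∈ L := by
    refine L.mul_mem (pow_mem ?_ n) (hggL b hb _)
    rw [eval_eq_sum_range]
    exact L.sum_mem fun i _ => L.mul_mem (hLh _ _) (pow_mem (L.inv_mem (hcL b)) i)
  have hIap (τ : L →ₐ[E] M) (b : K[X]) (hb : b ∈ t) :
      w τ (I b - (G (S₂ τ) (k S₁)).eval (c b)⁻¹) ≤
        w τ (c b)⁻¹ ^ (2 * m S₁ + 3) * w τ (algebraMap K[X] M X) ^ (R : ℤ) := by
    have h1 := hap τ b (htS b hb) (S₂ τ) (k S₁)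
    rw [← hggy τ b hb] at h1
    refine h1.trans (mul_le_mul' (pow_le_pow_right_of_le_one' ?_ (by omega)) le_rfl)
    rw [hcw τ b (htS b hb)]
    exact (hw τ).zpow_le_one (by omega)
  have hGR (τ : L →ₐ[E] M) (l : ℕ) : w τ ((G (S₂ τ) (k S₁)).coeff l) ≤
      w τ (algebraMap K[X] M X) ^ (R : ℤ) :=
    (e3 (S₂ τ) S₁ (w τ) (hw τ) l).trans ((hw τ).zpow_le_zpow (by exact_mod_cast hrR))
  have hHm : 2 * R + e * (m S₁ + 2) < H := by
    have := Nat.mul_le_mul_left e (Nat.add_le_add_right hm₁ 2)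
    omega
  set V := ∏ b ∈ t, ∏ b' ∈ t.erase b, (c b' - c b) with hV
  set W := ∑ b ∈ t, c b ^ m S₁ * I b / ∏ b' ∈ t.erase b, (c b' - c b) with hW
  have hcint (b : K[X]) : IsIntegral K[X] (c b) := isIntegral_algebraMap
  have hcinj : Function.Injective c := fun b b' hbb =>
    add_left_cancel (FaithfulSMul.algebraMap_injective K[X] M hbb)
  have hc0 (b : K[X]) (hb : b ∈ t) : c b ≠ 0 := by
    rw [← (w L.val).ne_zero_iff, map_X_pow_add heH htdeg (hw L.val) hb]
    exact zpow_ne_zero _ (hw L.val).ne_zero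
  have hV0 : V ≠ 0 := Finset.prod_ne_zero_iff.2 fun b _ => Finset.prod_ne_zero_iff.2 fun b' hb' =>
    sub_ne_zero.2 fun h => Finset.ne_of_mem_erase hb' (hcinj h)
  have hW0 : W ≠ 0 := sum_div_prod_sub_ne_zero heH htdeg htcard (hw L.val) (by omega)
    (hGR L.val) (by
      rw [hS₂]
      exact ((hw L.val).zpow_le_zpow (by omega)).trans (e4 S₁ hne (w L.val) (hw L.val)))
    (hIap L.val)
  have hint : IsIntegral K[X] (algebraMap K[X] M d ^ n * V * W) := by
    refine isIntegral_mul_sum_div_prod_sub (fun b _ => hcint b) hcinj.injOn fun b hb => ?_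
    simp only [hI]
    rw [← mul_assoc, hggy L.val b hb]
    exact isIntegral_coeff_prod_of_map_eval hD (hcint b) hd0' (hc0 b hb) hd
      (hl L.val b (htS b hb)) (hy L.val b (htS b hb)) _ _ _ (hS' S₁ hne.1 hne.2).2.1
  have hlt1 (τ : L →ₐ[E] M) : w τ (algebraMap K[X] M d ^ n * V * W) < 1 :=
    map_mul_sum_div_prod_sub_lt_one heH htdeg htcard (hw τ)
      ((e5 (w τ) (hw τ)).trans ((hw τ).zpow_le_zpow (by exact_mod_cast hrR))) hHm (hGR τ) (hIap τ)
  have hxL : algebraMap K[X] M d ^ n * V * W ∈ L := by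
    refine L.mul_mem (L.mul_mem (pow_mem ?_ n) ?_) ?_
    · rw [IsScalarTower.algebraMap_apply K[X] E M]
      exact L.algebraMap_mem _
    · exact L.prod_mem fun b _ => L.prod_mem fun b' _ => L.sub_mem (hcL _) (hcL _)
    · exact L.sum_mem fun b hb => L.div_mem (L.mul_mem (pow_mem (hcL b) _) (hIL b hb))
        (L.prod_mem fun b' _ => L.sub_mem (hcL _) (hcL _))
  refine mul_ne_zero (mul_ne_zero (pow_ne_zero n hd0') hV0) hW0
    (eq_zero_of_isIntegral (E := E) hv hint fun σ => ?_)
  have h1 : σ (algebraMap K[X] M d ^ n * V * W) =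
      lift (σ.comp L.val) (algebraMap K[X] M d ^ n * V * W) :=
    (hlift (σ.comp L.val) ⟨_, hxL⟩).symm
  rw [h1]
  exact hlt1 _

end Valuation.IsAtInfinity

theorem Polynomial.irreducible_of_forall_monic {L : Type*} [Field L] {p : L[X]}
    (hp : 0 < p.natDegree)
    (h : ∀ g g' : L[X], g.Monic → g'.Monic → 0 < g.natDegree → 0 < g'.natDegree →
      p ≠ C p.leadingCoeff * (g * g')) : Irreducible p := by
  have hp0 : p ≠ 0 := by rintro rfl; simp at hp
  have hlead : p.leadingCoeff ≠ 0 := leadingCoeff_ne_zero.2 hp0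
  have hmon : (p * C p.leadingCoeff⁻¹).Monic := monic_mul_leadingCoeff_inv hp0
  have hu : IsUnit (C p.leadingCoeff⁻¹) := isUnit_C.2 (inv_ne_zero hlead).isUnit
  rw [← irreducible_mul_isUnit hu, hmon.irreducible_iff_natDegree]
  refine ⟨fun h1 => ?_, fun g g' hg hg' hgg => ?_⟩
  · have := congrArg natDegree h1
    rw [natDegree_mul_C (inv_ne_zero hlead), natDegree_one] at this
    omega
  · by_contra! h0
    refine h g g' hg hg' (Nat.pos_of_ne_zero h0.1) (Nat.pos_of_ne_zero h0.2) ?_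
    rw [hgg, mul_comm p, ← mul_assoc, ← C_mul, mul_inv_cancel₀ hlead, C_1, one_mul]

theorem Polynomial.exists_separable_map_eval {F M : Type*} [Field F] [Infinite F] [Field M]
    [Algebra F M] {f : F[X][X]} (hirr : Irreducible (f.map (mapRingHom (algebraMap F M))))
    (hder : f.derivative ≠ 0) :
    ∃ x : F, f.leadingCoeff.eval x ≠ 0 ∧ (f.map (evalRingHom x)).Separable := by
  set i := mapRingHom (algebraMap F M)
  have hi : Function.Injective i := map_injective _ (algebraMap F M).injective
  set φ : F[X] →+* FractionRing M[X] := (algebraMap M[X] (FractionRing M[X])).comp i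
  have hφ : Function.Injective φ :=
    (FaithfulSMul.algebraMap_injective M[X] (FractionRing M[X])).comp hi
  have hdeg : (f.map i).natDegree ≠ 0 := by
    rw [natDegree_map_eq_of_injective hi]
    intro h0
    rw [eq_C_of_natDegree_eq_zero h0, derivative_C] at hder
    exact hder rfl
  have hirr' : Irreducible (f.map φ) := by
    rw [← Polynomial.map_map]
    exact ((hirr.isPrimitive hdeg).irreducible_iff_irreducible_map_fraction_map).1 hirr
  have hsep : (f.map φ).Separable := by
    rw [separable_iff_derivative_ne_zero hirr', derivative_map]
    exact fun h0 => hder (map_injective _ hφ (by rw [h0, Polynomial.map_zero]))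
  have hres : f.resultant f.derivative ≠ 0 := by
    intro h0
    refine resultant_ne_zero _ _ hsep ?_
    rw [derivative_map, natDegree_map_eq_of_injective hφ, natDegree_map_eq_of_injective hφ,
      resultant_map_map, h0, map_zero]
  have hf0 : f ≠ 0 := by rintro rfl; simp at hder
  obtain ⟨x, hx⟩ : ∃ x, (f.leadingCoeff * f.resultant f.derivative).eval x ≠ 0 := by
    by_contra! h0
    exact mul_ne_zero (leadingCoeff_ne_zero.2 hf0) hres (funext fun x => by rw [h0, eval_zero])
  rw [eval_mul] at hx
  refine ⟨x, left_ne_zero_of_mul hx, ?_⟩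
  obtain ⟨p, q, -, -, hpq⟩ := exists_mul_add_mul_eq_C_resultant f f.derivative le_rfl le_rfl
    (Or.inl (natDegree_map_eq_of_injective hi f ▸ hdeg))
  have h1 := congrArg (Polynomial.map (evalRingHom x)) hpq
  rw [Polynomial.map_add, Polynomial.map_mul, Polynomial.map_mul, ← derivative_map, map_C,
    coe_evalRingHom] at h1
  have hu : C ((f.resultant f.derivative).eval x)⁻¹ * C ((f.resultant f.derivative).eval x) =
      1 := by
    rw [← C_mul, inv_mul_cancel₀ (right_ne_zero_of_mul hx), C_1]
  exact ⟨C ((f.resultant f.derivative).eval x)⁻¹ * p.map (evalRingHom x),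
    C ((f.resultant f.derivative).eval x)⁻¹ * q.map (evalRingHom x), by
      linear_combination C ((f.resultant f.derivative).eval x)⁻¹ * h1 + hu⟩

theorem IntermediateField.exists_card_le_of_not_irreducible (K E : Type*) {F : Type*} [Field K]
    [Field E] [Field F] [Algebra K[X] E] [IsFractionRing K[X] E] [Algebra K[X] F] [Algebra E F]
    [IsScalarTower K[X] E F] [FiniteDimensional E F] {f : F[X][X]}
    (hirr : Irreducible (f.map (mapRingHom (algebraMap F (AlgebraicClosure F)))))
    (hder : f.derivative ≠ 0) :
    ∃ (x : F) (H : ℕ → ℕ), (∀ e, e < H e) ∧ ∀ L : IntermediateField F (AlgebraicClosure F),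
      FiniteDimensional F L → ∃ B : ℕ, ∀ e, ∀ s : Finset K[X], (∀ b ∈ s, b.natDegree ≤ e ∧
        ¬ (f.leadingCoeff.eval (x + (algebraMap K[X] F (X ^ H e + b))⁻¹) ≠ 0 ∧ Irreducible
          ((f.map (evalRingHom (x + (algebraMap K[X] F (X ^ H e + b))⁻¹))).map
            (algebraMap F L)))) → s.card ≤ B := by
  classical
  have hKE : Function.Injective (algebraMap K[X] E) := IsFractionRing.injective K[X] E
  have hKF : Function.Injective (algebraMap K[X] F) := by
    rw [IsScalarTower.algebraMap_eq K[X] E F]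
    exact (algebraMap E F).injective.comp hKE
  have : Infinite F := Infinite.of_injective _ hKF
  obtain ⟨x, hx, hsep⟩ := exists_separable_map_eval hirr hder
  set M := AlgebraicClosure F
  have : FaithfulSMul K[X] M := by
    rw [faithfulSMul_iff_algebraMap_injective, IsScalarTower.algebraMap_eq K[X] F M]
    exact (algebraMap F M).injective.comp hKF
  have : Algebra.IsAlgebraic E M := Algebra.IsAlgebraic.trans E F M
  have : Algebra.IsAlgebraic K[X] M :=
    (IsFractionRing.comap_isAlgebraic_iff (A := K[X]) (K := E) (C := M)).2 inferInstance
  obtain ⟨v, hv⟩ := Valuation.IsAtInfinity.exists_isAtInfinity K M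
  set T := taylorEquiv (algebraMap F M x)
  set i := mapRingHom (algebraMap F M)
  have hi : Function.Injective i := Polynomial.map_injective _ (algebraMap F M).injective
  set h : M[X][X] := (f.map i).map (T : M[X] →+* M[X]) with hh
  have hTinj : Function.Injective (T : M[X] →+* M[X]) := T.injective
  have hhirr : Irreducible h :=
    (MulEquiv.irreducible_iff (mapEquiv (T : M[X] ≃+* M[X]))).2 hirr
  have hT (z : M) (p : F[X]) :
      (T (i p)).eval z = (p.map (algebraMap F M)).eval (algebraMap F M x + z) := by
    rw [add_comm]; exact taylor_eval _ _ _
  have heval (z : F) : h.map (evalRingHom (algebraMap F M z)) =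
      (f.map (evalRingHom (x + z))).map (algebraMap F M) := by
    ext k
    rw [hh]
    simp only [coeff_map, coe_evalRingHom]
    refine (hT _ _).trans ?_
    rw [← map_add, eval_map_apply]
  have hdeg : h.natDegree = f.natDegree := by
    rw [natDegree_map_eq_of_injective hTinj, natDegree_map_eq_of_injective hi]
  have hlead (z : F) : h.leadingCoeff.eval (algebraMap F M z) =
      algebraMap F M (f.leadingCoeff.eval (x + z)) := by
    rw [leadingCoeff, hdeg, hh, coeff_map, coeff_map]
    refine (hT _ _).trans ?_
    rw [← map_add, eval_map_apply, coeff_natDegree]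
  have hlead0 : h.leadingCoeff.eval 0 ≠ 0 := by
    have h1 := hlead 0
    rw [map_zero, add_zero] at h1
    rw [h1]
    exact (_root_.map_ne_zero (algebraMap F M)).2 hx
  have hsep0 : (h.map (evalRingHom 0)).Separable := by
    rw [← map_zero (algebraMap F M), heval, add_zero]
    exact hsep.map
  obtain ⟨H, hH, hHL⟩ := hv.exists_card_le_of_factorsAt (E := E) hhirr hlead0 hsep0
  refine ⟨x, H, hH, fun L hL => ?_⟩
  have : FiniteDimensional E (L.restrictScalars E) := by
    have : FiniteDimensional E L := FiniteDimensional.trans E F L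
    exact this
  obtain ⟨B, hB⟩ := hHL (L.restrictScalars E) this fun j k => by
    have h1 : h.coeff j = (taylor x (f.coeff j)).map (algebraMap F M) := by
      rw [hh, coeff_map, coeff_map]
      exact (map_taylor _ _ _).symm
    rw [h1, coeff_map]
    exact L.algebraMap_mem _
  refine ⟨B + f.leadingCoeff.roots.toFinset.card, fun e s hs => ?_⟩
  set a : K[X] → F := fun b => x + (algebraMap K[X] F (X ^ H e + b))⁻¹ with ha
  have hainj : Function.Injective a := fun b b' hbb =>
    add_left_cancel (hKF (inv_injective (add_left_cancel hbb)))
  have hf0 : f ≠ 0 := by rintro rfl; simp at hder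
  rw [← Finset.card_filter_add_card_filter_not (s := s) fun b => f.leadingCoeff.eval (a b) ≠ 0]
  refine add_le_add (hB e _ fun b hb => ?_) ?_
  · rw [Finset.mem_filter] at hb
    refine ⟨(hs b hb.1).1, ?_⟩
    have hirrL := fun h0 => (hs b hb.1).2 ⟨hb.2, h0⟩
    have hz : (algebraMap K[X] M (X ^ H e + b))⁻¹ =
        algebraMap F M (algebraMap K[X] F (X ^ H e + b))⁻¹ := by
      rw [map_inv₀, ← IsScalarTower.algebraMap_apply]
    set p := (f.map (evalRingHom (a b))).map (algebraMap F L)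
    have hpn : p.natDegree = f.natDegree := by
      rw [natDegree_map]
      exact natDegree_map_of_leadingCoeff_ne_zero _ hb.2
    have hpos : 0 < p.natDegree := by
      rw [hpn]
      by_contra! h0
      rw [eq_C_of_natDegree_eq_zero (Nat.le_zero.1 h0), derivative_C] at hder
      exact hder rfl
    have hex := mt (irreducible_of_forall_monic hpos) hirrL
    push Not at hex
    obtain ⟨g, g', hg, hg', hgpos, hgpos', hgg⟩ := hex
    refine ⟨g.map (algebraMap L M), g'.map (algebraMap L M), hg.map _, hg'.map _,
      by rwa [natDegree_map], by rwa [natDegree_map], fun k => ?_, fun k => ?_, ?_⟩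
    · rw [coeff_map]; exact (g.coeff k).2
    · rw [coeff_map]; exact (g'.coeff k).2
    · have hpl : p.leadingCoeff = algebraMap F L (f.leadingCoeff.eval (a b)) := by
        rw [leadingCoeff, hpn, coeff_map, coeff_map, coeff_natDegree, coe_evalRingHom]
      have h1 := congrArg (Polynomial.map (algebraMap L M)) hgg
      rw [hpl, Polynomial.map_mul, Polynomial.map_mul, map_C, Polynomial.map_map,
        ← IsScalarTower.algebraMap_eq, ← IsScalarTower.algebraMap_apply] at h1
      rw [hz, heval, hlead]
      exact h1
  · rw [← Finset.card_image_of_injective _ hainj]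
    refine Finset.card_le_card fun y hy => ?_
    obtain ⟨b, hb, rfl⟩ := Finset.mem_image.1 hy
    rw [Multiset.mem_toFinset, mem_roots (leadingCoeff_ne_zero.2 hf0)]
    exact not_not.1 (Finset.mem_filter.1 hb).2

theorem Polynomial.exists_forall_not_of_mk_lt.{u, v} {K : Type u} {F : Type v} [Semiring K]
    [Nontrivial K]
    (bad : Finset F → F → Prop) (hmono : ∀ S T a, S ⊆ T → bad S a → bad T a) (α : ℕ → K[X] → F)
    (hbad : ∀ S, ∃ B, ∀ e, ∀ s : Finset K[X],
      (∀ b ∈ s, b.natDegree ≤ e ∧ bad S (α e b)) → s.card ≤ B)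
    (hF : Cardinal.lift.{u} (Cardinal.mk F) ≤ max (Cardinal.lift.{v} (Cardinal.mk K)) .aleph0)
    {A : Set F} (hA : Cardinal.mk A < Cardinal.mk F) :
    ∃ a, ∀ S : Finset F, (S : Set F) ⊆ A → ¬ bad S a := by
  classical
  obtain hfin | hinf := A.finite_or_infinite
  · obtain ⟨B, hB⟩ := hbad hfin.toFinset
    have hinj : Function.Injective fun i : ℕ => (X : K[X]) ^ i := fun i j hij => by
      simpa using congrArg natDegree hij
    obtain ⟨b, -, hb⟩ : ∃ b ∈ (Finset.range (B + 1)).image fun i : ℕ => (X : K[X]) ^ i,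
        ¬ bad hfin.toFinset (α B b) := by
      by_contra! h
      have := hB B _ fun b hb => ⟨?_, h b hb⟩
      · rw [Finset.card_image_of_injective _ hinj, Finset.card_range] at this
        omega
      · obtain ⟨i, hi, rfl⟩ := Finset.mem_image.1 hb
        rw [natDegree_X_pow]
        exact Nat.lt_succ_iff.1 (Finset.mem_range.1 hi)
    exact ⟨α B b, fun S hS h => hb (hmono _ _ _ (by simpa using hS) h)⟩
  · have : Infinite A := hinf.to_subtype
    have hA0 : Cardinal.aleph0 < Cardinal.lift.{u} (Cardinal.mk F) := by
      rw [Cardinal.aleph0_lt_lift]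
      exact (Cardinal.aleph0_le_mk A).trans_lt hA
    have hFK := (le_max_iff.1 hF).resolve_right hA0.not_ge
    have : Infinite K := by
      rw [Cardinal.infinite_iff, ← Cardinal.aleph0_le_lift.{u, v}]
      exact hA0.le.trans hFK
    by_contra! h
    have (k : K) : ∃ S : Finset A, bad (S.map (Function.Embedding.subtype _)) (α 0 (C k)) := by
      obtain ⟨S, hS, hk⟩ := h (α 0 (C k))
      refine ⟨S.subtype (· ∈ A), ?_⟩
      rwa [Finset.subtype_map_of_mem hS]
    choose φ hφ using this
    obtain ⟨S, hS⟩ := Cardinal.exists_infinite_fiber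
      (fun k : ULift.{v} K => ULift.up.{u} (φ k.down)) (by
        rw [Cardinal.mk_uLift, Cardinal.mk_uLift, Cardinal.mk_finset_of_infinite]
        exact (Cardinal.lift_lt.2 hA).trans_le hFK)
    obtain ⟨B, hB⟩ := hbad (S.down.map (Function.Embedding.subtype _))
    obtain ⟨t, ht, htc⟩ := (Set.infinite_coe_iff.1 hS).exists_subset_card_eq (B + 1)
    have := hB 0 (t.image fun k => C k.down) fun b hb => ?_
    · rw [Finset.card_image_of_injective (f := fun k => C (ULift.down k)) _
        (C_injective.comp ULift.down_injective), htc] at this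
      omega
    · obtain ⟨k, hk, rfl⟩ := Finset.mem_image.1 hb
      refine ⟨by rw [natDegree_C], ?_⟩
      have hk' : φ k.down = S.down := congrArg ULift.down (ht hk)
      rw [← hk']
      exact hφ k.down

namespace IntermediateField

variable {F M : Type*} [Field F] [Field M] [Algebra F M]

theorem finrank_adjoin_insert_of_irreducible (S : Set M) {y : M} {p : F[X]}
    (hp : Irreducible (p.map (algebraMap F (adjoin F S)))) (hy : aeval y p = 0) :
    Module.finrank F (adjoin F (insert y S)) =
      Module.finrank F (adjoin F S) * p.natDegree := by
  have hint : IsIntegral (adjoin F S) y :=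
    IsAlgebraic.isIntegral ⟨p.map (algebraMap F (adjoin F S)), hp.ne_zero, by
      rwa [aeval_map_algebraMap]⟩
  have h1 : (minpoly (adjoin F S) y).natDegree = p.natDegree := by
    rw [← minpoly.eq_of_irreducible hp (by rwa [aeval_map_algebraMap]),
      natDegree_mul_C (inv_ne_zero (leadingCoeff_ne_zero.2 hp.ne_zero)), natDegree_map]
  rw [← Set.union_singleton, ← adjoin_adjoin_left, ← h1, ← adjoin.finrank hint]
  exact (Module.finrank_mul_finrank F (adjoin F S) (adjoin (adjoin F S) {y})).symm

theorem irreducible_of_finrank_adjoin_simple {y : M} {p : F[X]} (hp : 0 < p.natDegree)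
    (hy : aeval y p = 0) (h : Module.finrank F F⟮y⟯ = p.natDegree) : Irreducible p := by
  have hp0 : p ≠ 0 := by rintro rfl; simp at hp
  have hint : IsIntegral F y := IsAlgebraic.isIntegral ⟨p, hp0, hy⟩
  rw [adjoin.finrank hint] at h
  have h1 := associated_of_dvd_of_natDegree_le (minpoly.dvd F y hy) hp0 h.ge
  exact h1.irreducible (minpoly.irreducible hint)

theorem linearDisjoint_adjoin_of_forall_finset [Algebra.IsAlgebraic F M] (A : IntermediateField F M)
    {S : Set M} (h : ∀ T : Finset M, (T : Set M) ⊆ S → A.LinearDisjoint (adjoin F (T : Set M))) :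
    A.LinearDisjoint (adjoin F S) := by
  classical
  rw [linearDisjoint_iff']
  have : Algebra.IsIntegral F (adjoin F S).toSubalgebra :=
    inferInstanceAs (Algebra.IsIntegral F (adjoin F S))
  refine Subalgebra.LinearDisjoint.of_linearDisjoint_finite_right _ _ fun B' hB' _ => ?_
  obtain ⟨s, hs⟩ : B'.FG := (Subalgebra.fg_iff_finiteType _).2 inferInstance
  have h1 (x : s) : ∃ T : Finset M, (T : Set M) ⊆ S ∧ (x : M) ∈ adjoin F (T : Set M) :=
    exists_finset_of_mem_adjoin (hB' (hs ▸ Algebra.subset_adjoin x.2))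
  choose T hTS hT using h1
  have h2 := h (s.attach.biUnion T) (by simpa using hTS)
  rw [linearDisjoint_iff'] at h2
  refine h2.of_le_right_of_flat ?_
  rw [← hs, Algebra.adjoin_le_iff]
  intro x hx
  refine adjoin.mono F _ _ ?_ (hT ⟨x, hx⟩)
  exact_mod_cast Finset.subset_biUnion_of_mem T (Finset.mem_attach s ⟨x, hx⟩)

end IntermediateField

namespace IntermediateField

variable {F M : Type*} [Field F] [Field M] [Algebra F M]

/-- A maximality argument: if any small set of specializations can be avoided, there is a large
set of specializations whose roots generate extensions of the largest possible degree. -/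
theorem exists_set_finrank_adjoin_image {n : ℕ} (p : F → F[X]) (b : F → M)
    (h : ∀ A : Set F, Cardinal.mk A < Cardinal.mk F → ∃ a, ∀ S : Finset F, (S : Set F) ⊆ A →
      a ∉ S ∧ (p a).natDegree = n ∧ aeval (b a) (p a) = 0 ∧
        Irreducible ((p a).map (algebraMap F (adjoin F (b '' S))))) :
    ∃ A : Set F, Cardinal.mk A = Cardinal.mk F ∧ ∀ S : Finset F, (S : Set F) ⊆ A →
      (∀ a ∈ S, (p a).natDegree = n ∧ aeval (b a) (p a) = 0) ∧
        Module.finrank F (adjoin F (b '' S)) = n ^ S.card := by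
  classical
  let P : Finset F → Prop := fun S => (∀ a ∈ S, (p a).natDegree = n ∧ aeval (b a) (p a) = 0) ∧
    Module.finrank F (adjoin F (b '' S)) = n ^ S.card
  have hfin : Order.IsOfFiniteCharacter {A : Set F | ∀ S : Finset F, (S : Set F) ⊆ A → P S} :=
    fun A => ⟨fun hA y hy _ S hS => hA S (hS.trans hy),
      fun hA S hS => hA S hS S.finite_toSet S subset_rfl⟩
  have hempty : (∅ : Set F) ∈ {A : Set F | ∀ S : Finset F, (S : Set F) ⊆ A → P S} := by
    intro S hS
    obtain rfl : S = ∅ := by simpa using hS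
    refine ⟨by simp, ?_⟩
    simp
  obtain ⟨A, -, hA⟩ := hfin.exists_maximal hempty
  refine ⟨A, ?_, hA.1⟩
  by_contra hne
  obtain ⟨a, ha⟩ := h A ((Cardinal.mk_set_le A).lt_of_ne hne)
  have haA : a ∉ A := fun haA => (ha {a} (by simpa using haA)).1 (by simp)
  refine haA (hA.2 (y := insert a A) (fun S hS => ?_) (Set.subset_insert a A)
    (Set.mem_insert a A))
  by_cases haS : a ∈ S
  · have hS' : ((S.erase a : Finset F) : Set F) ⊆ A := by
      rw [Finset.coe_erase, Set.sdiff_singleton_subset_iff]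
      exact hS
    obtain ⟨h1, h2, h3, h4⟩ := ha _ hS'
    obtain ⟨h5, h6⟩ := hA.1 _ hS'
    have h7 := finrank_adjoin_insert_of_irreducible _ h4 h3
    rw [← Set.image_insert_eq, ← Finset.coe_insert, Finset.insert_erase haS, h6, h2, ← pow_succ,
      Finset.card_erase_add_one haS] at h7
    refine ⟨fun a' ha' => ?_, h7⟩
    by_cases haa : a' = a
    · rw [haa]; exact ⟨h2, h3⟩
    · exact h5 a' (Finset.mem_erase.2 ⟨haa, ha'⟩)
  · exact hA.1 S ((Set.subset_insert_iff_of_notMem (by simpa using haS)).1 hS)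

theorem linearDisjoint_of_finrank_adjoin_image [Algebra.IsAlgebraic F M] {n : ℕ} {b : F → M}
    {A : Set F} (h : ∀ S : Finset F, (S : Set F) ⊆ A →
      Module.finrank F (adjoin F (b '' S)) = n ^ S.card) {a : F} (ha : a ∈ A) :
    F⟮b a⟯.LinearDisjoint (adjoin F (b '' (A \ {a}))) := by
  classical
  refine linearDisjoint_adjoin_of_forall_finset _ fun T hT => ?_
  obtain ⟨S, hS, rfl⟩ := Finset.subset_set_image_iff.1 hT
  have : FiniteDimensional F F⟮b a⟯ :=
    adjoin.finiteDimensional (Algebra.IsIntegral.isIntegral _)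
  rw [Finset.coe_image]
  have : FiniteDimensional F (adjoin F (b '' (S : Set F))) :=
    finiteDimensional_adjoin fun x _ => Algebra.IsIntegral.isIntegral x
  have haS : a ∉ S := fun haS => (hS haS).2 rfl
  have h1 := h {a} (by simpa using ha)
  rw [Finset.coe_singleton, Set.image_singleton, Finset.card_singleton, pow_one] at h1
  have hSA : (S : Set F) ⊆ A := hS.trans Set.sdiff_subset
  refine LinearDisjoint.of_finrank_sup ?_
  rw [← adjoin_union, Set.singleton_union, ← Set.image_insert_eq, ← Finset.coe_insert, h, h S hSA,
    h1, Finset.card_insert_of_notMem haS, pow_succ']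
  rw [Finset.coe_insert]
  exact Set.insert_subset ha hSA

end IntermediateField

/-- A finite extension of a rational function field `K(X)` is fully Hilbertian. -/
theorem isFullyHilbertian_of_finiteDimensional (K E F : Type) [Field K] [Field E] [Field F]
    [Algebra K[X] E] [IsFractionRing K[X] E] [Algebra K[X] F] [Algebra E F]
    [IsScalarTower K[X] E F] [FiniteDimensional E F] : IsFullyHilbertian F := by
  classical
  intro f hirr hder
  have hKF : Function.Injective (algebraMap K[X] F) := by
    rw [IsScalarTower.algebraMap_eq K[X] E F]
    exact (algebraMap E F).injective.comp (IsFractionRing.injective K[X] E)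
  have : FaithfulSMul K[X] F := (faithfulSMul_iff_algebraMap_injective _ _).2 hKF
  have : Algebra.IsAlgebraic K[X] F :=
    (IsFractionRing.comap_isAlgebraic_iff (A := K[X]) (K := E) (C := F)).2 inferInstance
  have hcard : Cardinal.mk F ≤ max (Cardinal.mk K) .aleph0 :=
    (Algebra.IsAlgebraic.cardinalMk_le_max K[X] F).trans
      (max_le cardinalMk_le_max (le_max_right _ _))
  set M := AlgebraicClosure F
  have hn : 0 < f.natDegree := by
    by_contra! h0
    rw [eq_C_of_natDegree_eq_zero (Nat.le_zero.1 h0), derivative_C] at hder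
    exact hder rfl
  set p : F → F[X] := fun a => f.map (evalRingHom a)
  have hp (a : F) (ha : f.leadingCoeff.eval a ≠ 0) : (p a).natDegree = f.natDegree :=
    natDegree_map_of_leadingCoeff_ne_zero _ ha
  have hroot (a : F) : ∃ y : M, f.leadingCoeff.eval a ≠ 0 → aeval y (p a) = 0 := by
    by_cases ha : f.leadingCoeff.eval a ≠ 0
    · obtain ⟨y, hy⟩ := IsAlgClosed.exists_aeval_eq_zero M (p a)
        (natDegree_pos_iff_degree_pos.1 (by rwa [hp a ha])).ne'
      exact ⟨y, fun _ => hy⟩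
    · exact ⟨0, fun h => absurd h ha⟩
  choose b hb using hroot
  obtain ⟨x, H, hH, hHL⟩ := IntermediateField.exists_card_le_of_not_irreducible K E hirr hder
  let bad : Finset F → F → Prop := fun S a => a ∈ S ∨ ¬ (f.leadingCoeff.eval a ≠ 0 ∧
    Irreducible ((p a).map (algebraMap F (IntermediateField.adjoin F (b '' S)))))
  have hmono (S T : Finset F) (a : F) (hST : S ⊆ T) (h : bad S a) : bad T a := by
    refine h.imp (fun h => hST h) fun h h' => h ⟨h'.1, ?_⟩
    have hle : IntermediateField.adjoin F (b '' (S : Set F)) ≤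
        IntermediateField.adjoin F (b '' (T : Set F)) :=
      IntermediateField.adjoin.mono F _ _ (Set.image_mono hST)
    have : IsLocalHom (mapRingHom (IntermediateField.inclusion hle).toRingHom) :=
      ⟨fun q hq => (isUnit_map _).1 hq⟩
    refine Irreducible.of_map (f := mapRingHom (IntermediateField.inclusion hle).toRingHom) ?_
    rw [coe_mapRingHom, Polynomial.map_map]
    exact h'.2
  have hbad (S : Finset F) : ∃ B, ∀ e, ∀ s : Finset K[X], (∀ c ∈ s, c.natDegree ≤ e ∧
      bad S (x + (algebraMap K[X] F (X ^ H e + c))⁻¹)) → s.card ≤ B := by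
    have : FiniteDimensional F (IntermediateField.adjoin F (b '' (S : Set F))) :=
      IntermediateField.finiteDimensional_adjoin fun x _ => Algebra.IsIntegral.isIntegral x
    obtain ⟨B, hB⟩ := hHL (IntermediateField.adjoin F (b '' (S : Set F))) this
    refine ⟨S.card + B, fun e s hs => ?_⟩
    set α : K[X] → F := fun c => x + (algebraMap K[X] F (X ^ H e + c))⁻¹
    have hα : Function.Injective α := fun c c' hcc =>
      add_left_cancel (hKF (inv_injective (add_left_cancel hcc)))
    rw [← Finset.card_filter_add_card_filter_not (s := s) fun c => α c ∈ S]
    refine add_le_add ?_ (hB e _ fun c hc => ?_)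
    · exact Finset.card_le_card_of_injOn α (fun c hc => (Finset.mem_filter.1 hc).2) hα.injOn
    · rw [Finset.mem_filter] at hc
      exact ⟨(hs c hc.1).1, (hs c hc.1).2.resolve_left hc.2⟩
  obtain ⟨A, hAF, hA⟩ := IntermediateField.exists_set_finrank_adjoin_image (n := f.natDegree) p b
    fun A hA => by
      obtain ⟨a, ha⟩ := exists_forall_not_of_mk_lt bad hmono
        (fun e c => x + (algebraMap K[X] F (X ^ H e + c))⁻¹) hbad (by simpa using hcard) hA
      refine ⟨a, fun S hS => ?_⟩
      have h1 := ha S hS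
      simp only [bad, not_or, not_not] at h1
      exact ⟨h1.1, hp a h1.2.1, hb a h1.2.1, h1.2.2⟩
  have hA1 (a : F) (ha : a ∈ A) : (p a).natDegree = f.natDegree ∧ aeval (b a) (p a) = 0 :=
    (hA {a} (by simpa using ha)).1 a (Finset.mem_singleton_self a)
  refine ⟨A, fun a => b a, fun a ha => ?_, hAF, fun a => (hA1 a a.2).2, fun a => ?_⟩
  · refine IntermediateField.irreducible_of_finrank_adjoin_simple (y := b a) ?_ (hA1 a ha).2 ?_
    · rwa [(hA1 a ha).1]
    · have h1 := (hA {a} (by simpa using ha)).2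
      rw [Finset.coe_singleton, Set.image_singleton, Finset.card_singleton, pow_one] at h1
      rw [h1, (hA1 a ha).1]
  · refine (IntermediateField.linearDisjoint_of_finrank_adjoin_image
      (fun S hS => (hA S hS).2) a.2).of_le_right ?_
    refine iSup₂_le fun a' ha' => IntermediateField.adjoin.mono F _ _ ?_
    rw [Set.singleton_subset_iff]
    exact ⟨a', ⟨a'.2, fun h => ha' (Subtype.ext h)⟩, rfl⟩

/-- A finitely generated transcendental extension `F` of `K` is algebraic over the field obtained
from some intermediate field `L` by adjoining one element transcendental over `L`. -/
theorem IntermediateField.exists_transcendental_of_adjoin_finset_eq_top {K F : Type*} [Field K]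
    [Field F] [Algebra K F] {s : Finset F} (hs : IntermediateField.adjoin K (s : Set F) = ⊤)
    (htr : ¬ Algebra.IsAlgebraic K F) :
    ∃ (L : IntermediateField K F) (t : F),
      Transcendental L t ∧ Algebra.IsAlgebraic (IntermediateField.adjoin L {t}) F := by
  classical
  have hmem : s ∈ s.powerset.filter fun u : Finset F =>
      Algebra.IsAlgebraic (adjoin K (u : Set F)) F := by
    rw [Finset.mem_filter]
    refine ⟨Finset.mem_powerset_self s, ⟨fun y => ?_⟩⟩
    exact isAlgebraic_algebraMap (⟨y, hs ▸ mem_top⟩ : adjoin K (s : Set F))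
  obtain ⟨u, hu, hmin⟩ := Finset.exists_min_image _ Finset.card ⟨s, hmem⟩
  rw [Finset.mem_filter, Finset.mem_powerset] at hu
  have := hu.2
  obtain ⟨t, ht⟩ : u.Nonempty := by
    rw [Finset.nonempty_iff_ne_empty]
    rintro rfl
    rw [Finset.coe_empty, adjoin_empty] at this
    exact htr (Algebra.IsAlgebraic.trans K (⊥ : IntermediateField K F) F)
  have heq : (adjoin (adjoin K ((u.erase t : Finset F) : Set F)) {t}).restrictScalars K =
      adjoin K (u : Set F) := by
    rw [adjoin_adjoin_left, Set.union_singleton, ← Finset.coe_insert, Finset.insert_erase ht]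
  have halg : Algebra.IsAlgebraic (adjoin (adjoin K ((u.erase t : Finset F) : Set F)) {t}) F := by
    have h1 : Algebra.IsAlgebraic
      ((adjoin (adjoin K ((u.erase t : Finset F) : Set F)) {t}).restrictScalars K) F := heq ▸ this
    exact h1
  refine ⟨_, t, fun hta => ?_, halg⟩
  have h1 : Algebra.IsAlgebraic (adjoin K ((u.erase t : Finset F) : Set F))
      (adjoin (adjoin K ((u.erase t : Finset F) : Set F)) {t}) :=
    isAlgebraic_adjoin_simple hta.isIntegral
  have h2 : Algebra.IsAlgebraic (adjoin K ((u.erase t : Finset F) : Set F)) F :=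
    Algebra.IsAlgebraic.trans _ (adjoin (adjoin K ((u.erase t : Finset F) : Set F)) {t}) F
  exact (Finset.card_erase_lt_of_mem ht).not_ge (hmin _ (Finset.mem_filter.2
    ⟨Finset.mem_powerset.2 ((Finset.erase_subset t u).trans hu.1), h2⟩))

/-- Every finitely generated transcendental field extension `F` of an
arbitrary field `K` is fully Hilbertian. -/
theorem finitelyGenerated_transcendental_isFullyHilbertian
    (K F : Type) [Field K] [Field F] [Algebra K F]
    (hfg : ∃ s : Finset F, IntermediateField.adjoin K (s : Set F) = ⊤)
    (htr : ¬ Algebra.IsAlgebraic K F) :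
    IsFullyHilbertian F := by
  obtain ⟨s, hs⟩ := hfg
  obtain ⟨L, t, ht, halg⟩ :=
    IntermediateField.exists_transcendental_of_adjoin_finset_eq_top hs htr
  let _ : Algebra L[X] F := (aeval t : L[X] →ₐ[L] F).toRingHom.toAlgebra
  have : FaithfulSMul L[X] F := (faithfulSMul_iff_algebraMap_injective _ _).2
    (transcendental_iff_injective.1 ht)
  let E := FractionRing L[X]
  let _ : Algebra E F := FractionRing.liftAlgebra L[X] F
  have : IsScalarTower L[X] E F := inferInstance
  have hE (q : L[X]) : algebraMap E F (algebraMap L[X] E q) = aeval t q :=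
    (IsScalarTower.algebraMap_apply L[X] E F q).symm
  have : IsScalarTower L E F := IsScalarTower.of_algebraMap_eq fun k => by
    rw [IsScalarTower.algebraMap_apply L L[X] E, hE, ← aeval_C t k]
    rfl
  have : IsScalarTower K E F := IsScalarTower.of_algebraMap_eq fun k => by
    rw [IsScalarTower.algebraMap_apply K L F, IsScalarTower.algebraMap_apply L E F]
    rfl
  have halgE : Algebra.IsAlgebraic E F := by
    refine ⟨fun y => ?_⟩
    set Q := algebraicClosure E F
    have hle : IntermediateField.adjoin L {t} ≤ Q.restrictScalars L := by
      rw [IntermediateField.adjoin_simple_le_iff]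
      have h1 : algebraMap E F (algebraMap L[X] E X) = t := by rw [hE, aeval_X]
      rw [← h1]
      exact Q.algebraMap_mem _
    have h1 : IsAlgebraic (Q.restrictScalars L) y :=
      (halg.isAlgebraic y).tower_top_of_subalgebra_le hle
    have h2 : IsAlgebraic Q y := h1
    exact h2.restrictScalars E
  have : FiniteDimensional E F := by
    have h1 : IntermediateField.adjoin E (s : Set F) = ⊤ := by
      have h2 : IntermediateField.adjoin K (s : Set F) ≤
          (IntermediateField.adjoin E (s : Set F)).restrictScalars K := by
        rw [IntermediateField.adjoin_le_iff]
        exact IntermediateField.subset_adjoin E _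
      rw [hs] at h2
      exact top_le_iff.1 fun y _ => h2 (IntermediateField.mem_top (x := y))
    have h2 : FiniteDimensional E (IntermediateField.adjoin E (s : Set F)) :=
      IntermediateField.finiteDimensional_adjoin fun x _ => Algebra.IsIntegral.isIntegral x
    rw [h1] at h2
    exact Module.Finite.equiv (IntermediateField.topEquiv (F := E) (E := F)).toLinearEquiv
  exact isFullyHilbertian_of_finiteDimensional L E F
end

section
/- Let K be a fully Hilbertian field and E/K a purely inseparable algebraic extension. Then E is fully Hilbertian. -/
open Polynomial

/-- Raising the coefficients of an irreducible polynomial with nonzero derivative to the `p`-th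
power preserves irreducibility, over any factorial domain of exponential characteristic `p`. -/
theorem Polynomial.irreducible_map_frobenius {R : Type*} [CommRing R] [IsDomain R]
    [UniqueFactorizationMonoid R] (p : ℕ) [ExpChar R p] {f : R[X]} (hf : Irreducible f)
    (hf' : derivative f ≠ 0) : Irreducible (f.map (frobenius R p)) := by
  obtain _ | @⟨_, hp, _⟩ := ‹ExpChar R p›
  · have : frobenius R 1 = RingHom.id R := by ext; simp [frobenius_def]
    rwa [this, map_id]
  have : Fact p.Prime := ⟨hp⟩
  have hlocal : IsLocalHom (expand R p) := isLocalHom_expand R hp.pos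
  refine ⟨fun h ↦ ?_, fun g h hgh ↦ ?_⟩
  · have : IsUnit (f ^ p) := by
      rw [← map_frobenius_expand p f, map_expand]
      exact h.map (expand R p)
    exact hf.not_isUnit ((isUnit_pow_iff hp.ne_zero).1 this)
  · have hfp : f ^ p = expand R p g * expand R p h := by
      rw [← map_frobenius_expand p f, map_expand, hgh, map_mul]
    obtain ⟨i, hi, hgi⟩ := (dvd_prime_pow hf.prime p).1 ⟨_, hfp⟩
    rcases Nat.eq_zero_or_pos i with rfl | hi0
    · rw [pow_zero, associated_one_iff_isUnit] at hgi
      exact Or.inl (hlocal.map_nonunit _ hgi)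
    rcases hi.eq_or_lt with rfl | hip
    · right
      refine hlocal.map_nonunit (f := expand R i) _ ?_
      obtain ⟨u, hu⟩ := hgi
      have h0 : expand R i g ≠ 0 := fun h0 ↦ by
        rw [h0, zero_mul] at hfp
        exact hf.ne_zero (pow_eq_zero_iff hp.ne_zero |>.1 hfp)
      rw [← hu] at hfp
      exact (mul_left_cancel₀ h0 hfp) ▸ u.isUnit
    · exfalso
      obtain ⟨u, hu⟩ := hgi.symm
      obtain ⟨r, hr, hru⟩ := Polynomial.isUnit_iff.1 u.isUnit
      have hd := congrArg derivative hu
      have hi1 : (i : R) ≠ 0 := by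
        rw [Ne, CharP.cast_eq_zero_iff R p]
        exact fun hd ↦ (Nat.le_of_dvd hi0 hd).not_gt hip
      rw [derivative_expand, ← hru] at hd
      have hi1' : (i : R[X]) ≠ 0 := by rwa [← C_eq_natCast, Ne, C_eq_zero]
      simp [derivative_pow, hf.ne_zero, hf', hr.ne_zero, hi1'] at hd

theorem Polynomial.irreducible_map_iterateFrobenius {R : Type*} [CommRing R] [IsDomain R]
    [UniqueFactorizationMonoid R] (p n : ℕ) [ExpChar R p] {f : R[X]} (hf : Irreducible f)
    (hf' : derivative f ≠ 0) : Irreducible (f.map (iterateFrobenius R p n)) := by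
  induction n with
  | zero => rwa [iterateFrobenius_zero, map_id]
  | succ n ih =>
    have : iterateFrobenius R p (n + 1) = (frobenius R p).comp (iterateFrobenius R p n) := by
      ext x
      simp [iterateFrobenius_def, frobenius_def, pow_succ, pow_mul]
    rw [this, ← map_map]
    refine irreducible_map_frobenius p ih ?_
    rwa [derivative_map, Ne, Polynomial.map_eq_zero_iff (iterateFrobenius_inj R p n)]

theorem Polynomial.exists_mul_add_mul_derivative_eq_C {R : Type*} [CommRing R] [IsDomain R]
    [UniqueFactorizationMonoid R] {f : R[X]} (hf : Irreducible f) (hf' : derivative f ≠ 0) :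
    ∃ (a b : R[X]) (r : R), r ≠ 0 ∧ a * f + b * derivative f = C r := by
  let _ := Classical.arbitrary (NormalizedGCDMonoid R)
  let F := FractionRing R
  have hinj : Function.Injective (algebraMap R F) := IsFractionRing.injective R F
  have hdeg : f.natDegree ≠ 0 := fun h ↦ hf' (derivative_of_natDegree_zero h)
  have hirr : Irreducible (f.map (algebraMap R F)) :=
    (hf.isPrimitive hdeg).irreducible_iff_irreducible_map_fraction_map.1 hf
  obtain ⟨a, b, hab⟩ := (separable_iff_derivative_ne_zero hirr).2
    (by rwa [derivative_map, Ne, Polynomial.map_eq_zero_iff hinj])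
  obtain ⟨c, hc0, hc⟩ := IsLocalization.integerNormalization_spec (nonZeroDivisors R) a
  obtain ⟨d, hd0, hd⟩ := IsLocalization.integerNormalization_spec (nonZeroDivisors R) b
  refine ⟨C d * IsLocalization.integerNormalization (nonZeroDivisors R) a,
    C c * IsLocalization.integerNormalization (nonZeroDivisors R) b, c * d,
    mul_ne_zero (nonZeroDivisors.ne_zero hc0) (nonZeroDivisors.ne_zero hd0),
    map_injective _ hinj ?_⟩
  rw [derivative_map] at hab
  simp only [Polynomial.map_add, Polynomial.map_mul, hc, hd, map_C, Algebra.smul_def, map_mul,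
    Polynomial.algebraMap_apply]
  linear_combination (C (algebraMap R F c) * C (algebraMap R F d)) * hab

theorem Polynomial.finite_setOf_not_separable_map_eval {F : Type*} [Field F] {f : F[X][X]}
    (hf : Irreducible f) (hf' : derivative f ≠ 0) :
    {x : F | ¬ (f.map (evalRingHom x)).Separable}.Finite := by
  obtain ⟨a, b, r, hr, h⟩ := exists_mul_add_mul_derivative_eq_C hf hf'
  refine (r.finite_setOfPred_isRoot hr).subset fun x hx ↦ ?_
  by_contra hrx
  refine hx ?_
  have h1 := congrArg (Polynomial.map (evalRingHom x)) h
  simp only [Polynomial.map_add, Polynomial.map_mul, map_C, coe_evalRingHom,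
    ← derivative_map] at h1
  have hrx' : r.eval x ≠ 0 := hrx
  refine ⟨C (r.eval x)⁻¹ * a.map (evalRingHom x), C (r.eval x)⁻¹ * b.map (evalRingHom x), ?_⟩
  rw [mul_assoc, mul_assoc, ← mul_add, h1, ← C_mul, inv_mul_cancel₀ hrx', C_1]

theorem Polynomial.exists_map_eq_map_iterateFrobenius {R S : Type*} [CommRing R] [CommRing S]
    (i : R →+* S) (p : ℕ) [ExpChar S p] (hi : ∀ x : S, ∃ n : ℕ, x ^ p ^ n ∈ i.range) (f : S[X]) :
    ∃ (n : ℕ) (g : R[X]), g.map i = f.map (iterateFrobenius S p n) := by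
  choose n hn using hi
  let N := f.support.sup fun k ↦ n (f.coeff k)
  have : f.map (iterateFrobenius S p N) ∈ (mapRingHom i).range := by
    rw [mem_map_range]
    intro k
    rw [coeff_map, iterateFrobenius_def]
    by_cases hk : f.coeff k = 0
    · simp [hk, (expChar_pos S p).ne', zero_mem]
    have hle : n (f.coeff k) ≤ N :=
      Finset.le_sup (f := fun k ↦ n (f.coeff k)) (mem_support_iff.2 hk)
    rw [← Nat.add_sub_cancel' hle, pow_add, pow_mul]
    exact pow_mem (hn _) _
  exact ⟨N, this⟩

theorem Polynomial.exists_map_eq_map_iterateFrobenius_of_isPurelyInseparable (K : Type*)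
    {E : Type*} [Field K] [Field E] [Algebra K E] [IsPurelyInseparable K E] (p : ℕ)
    [ExpChar K p] [ExpChar E p] [ExpChar E[X] p] (f : E[X][X]) : ∃ (n : ℕ) (g : K[X][X]),
      g.map (mapRingHom (algebraMap K E)) = f.map (iterateFrobenius E[X] p n) := by
  refine Polynomial.exists_map_eq_map_iterateFrobenius _ p (fun c ↦ ?_) f
  obtain ⟨n, g, hg⟩ := Polynomial.exists_map_eq_map_iterateFrobenius (algebraMap K E) p
    (fun x ↦ IsPurelyInseparable.pow_mem K p x) c
  refine ⟨n, expand K (p ^ n) g, ?_⟩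
  rw [coe_mapRingHom, map_expand, hg, ← map_expand, map_iterateFrobenius_expand]

open IntermediateField in
theorem IntermediateField.LinearDisjoint.of_isPurelyInseparable {K E Ω : Type*} [Field K]
    [Field E] [Field Ω] [Algebra K E] [Algebra K Ω] [Algebra E Ω] [IsScalarTower K E Ω]
    [IsPurelyInseparable K E] {x : Ω} {M : IntermediateField K Ω} {N : IntermediateField E Ω}
    (hx : IsSeparable K x) (hN : N ≤ adjoin E (M : Set Ω)) (h : K⟮x⟯.LinearDisjoint M) : E⟮x⟯.LinearDisjoint N := by
  obtain ⟨p, _⟩ := ExpChar.exists K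
  have : ExpChar M p := expChar_of_injective_algebraMap (algebraMap K M).injective p
  let N' : IntermediateField M Ω := adjoin M (Set.range (algebraMap E Ω))
  have : IsPurelyInseparable M N' := by
    refine (isPurelyInseparable_adjoin_iff_pow_mem M Ω p).2 ?_
    rintro _ ⟨e, rfl⟩
    obtain ⟨n, y, hy⟩ := IsPurelyInseparable.pow_mem K p e
    refine ⟨n, algebraMap K M y, ?_⟩
    rw [← map_pow, ← hy, ← IsScalarTower.algebraMap_apply, ← IsScalarTower.algebraMap_apply]
  let N'' : IntermediateField E Ω :=
    N'.toSubfield.toIntermediateField fun e ↦ subset_adjoin M _ ⟨e, rfl⟩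
  have hN'' : N ≤ N'' := hN.trans <| adjoin_le_iff.2 fun m hm ↦ N'.algebraMap_mem ⟨m, hm⟩
  refine LinearDisjoint.of_le_right ?_ hN''
  have hxE : IsIntegral E x := hx.isIntegral.tower_top
  have hK : LinearIndependent K fun i : Fin (minpoly K x).natDegree ↦
      (AdjoinSimple.gen K x) ^ (i : ℕ) := by
    exact minpoly_gen K x ▸ linearIndependent_pow (K := K) (AdjoinSimple.gen K x)
  have hM := (h.linearIndependent_left hK).map_of_isPurelyInseparable_of_isSeparable
    (E := N') (fun i ↦ by
      have := (isSeparable_adjoin_simple_iff_isSeparable K Ω).2 hx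
      have := Algebra.IsSeparable.isSeparable K (AdjoinSimple.gen K x ^ (i : ℕ))
      exact ((isSeparable_map_iff K⟮x⟯.val K⟮x⟯.val.injective).2 this).tower_top M)
  have hle : (minpoly E x).natDegree ≤ (minpoly K x).natDegree := by
    rw [← natDegree_map (algebraMap K E)]
    exact natDegree_le_of_dvd (minpoly.dvd_map_of_isScalarTower K E x)
      ((minpoly.monic hx.isIntegral).map _).ne_zero
  refine LinearDisjoint.of_basis_left (adjoin.powerBasis hxE).basis ?_
  have := hM.comp (Fin.castLE hle) (Fin.castLE_injective hle)
  convert! this using 1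
  ext i
  simp
  rfl

theorem Polynomial.irreducible_of_irreducible_map {F L : Type*} [Field F] [Field L] (φ : F →+* L)
    {f : F[X]} (hf : Irreducible (f.map φ)) : Irreducible f :=
  have : IsLocalHom (mapRingHom φ) := ⟨fun _ ↦ (isUnit_map φ).1⟩
  Irreducible.of_map (f := mapRingHom φ) hf

theorem Cardinal.mk_eq_of_isPurelyInseparable (K E : Type) [Field K] [Field E] [Algebra K E]
    [IsPurelyInseparable K E] : Cardinal.mk K = Cardinal.mk E := by
  refine le_antisymm (mk_le_of_injective (algebraMap K E).injective) ?_
  rcases finite_or_infinite K with h | h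
  · exact mk_le_of_surjective (IsPurelyInseparable.surjective_algebraMap_of_isSeparable K E)
  · exact (Algebra.IsAlgebraic.cardinalMk_le_max K E).trans (by simp)

open IntermediateField in
/-- A purely inseparable (algebraic) extension of a fully Hilbertian
field is fully Hilbertian. -/
theorem purelyInseparable_isFullyHilbertian
    (K E : Type) [Field K] [Field E] [Algebra K E] [IsPurelyInseparable K E]
    (hK : IsFullyHilbertian K) :
    IsFullyHilbertian E := by
  intro f hf hf'
  obtain ⟨p, _⟩ := ExpChar.exists K
  let Ω := AlgebraicClosure E
  have : ExpChar E p := expChar_of_injective_algebraMap (algebraMap K E).injective p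
  have : ExpChar (Polynomial E) p := expChar_of_injective_algebraMap (C_injective (R := E)) p
  have : ExpChar Ω p := expChar_of_injective_algebraMap (algebraMap K Ω).injective p
  have : ExpChar (Polynomial Ω) p := expChar_of_injective_algebraMap (C_injective (R := Ω)) p
  have : IsAlgClosure K Ω := ⟨inferInstance, Algebra.IsAlgebraic.trans K E Ω⟩
  let φ : AlgebraicClosure K ≃ₐ[K] Ω := IsAlgClosure.equiv K _ _
  obtain ⟨n, g, hg⟩ := exists_map_eq_map_iterateFrobenius_of_isPurelyInseparable K p f
  have hmap {F L : Type} [Field F] [Field L] (i : F →+* L) :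
      Function.Injective (mapRingHom i) := map_injective _ i.injective
  have hfΩ' : derivative (f.map (mapRingHom (algebraMap E Ω))) ≠ 0 := by
    rwa [derivative_map, Ne, Polynomial.map_eq_zero_iff (hmap _)]
  have hgΩ : g.map (mapRingHom (algebraMap K Ω)) =
      (f.map (mapRingHom (algebraMap E Ω))).map (iterateFrobenius (Polynomial Ω) p n) := by
    have h := congrArg (Polynomial.map (mapRingHom (algebraMap E Ω))) hg
    rw [Polynomial.map_map, Polynomial.map_map, mapRingHom_comp, ← IsScalarTower.algebraMap_eq] at h
    rw [h, Polynomial.map_map]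
    congr 1
    refine RingHom.ext fun c ↦ ?_
    simp [iterateFrobenius_def]
  have hgirr : Irreducible (g.map (mapRingHom (algebraMap K (AlgebraicClosure K)))) := by
    rw [← MulEquiv.irreducible_iff (mapEquiv (mapEquiv φ.toRingEquiv))]
    convert! irreducible_map_iterateFrobenius p n hf hfΩ' using 1
    rw [← hgΩ]
    change Polynomial.map (mapRingHom (φ : AlgebraicClosure K →+* Ω)) _ = _
    rw [Polynomial.map_map, mapRingHom_comp]
    congr 2
    exact φ.toAlgHom.comp_algebraMap
  have hg' : derivative g ≠ 0 := by
    rw [← Polynomial.map_ne_zero_iff (hmap (algebraMap K E)), ← derivative_map, hg, derivative_map,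
      Polynomial.map_ne_zero_iff (iterateFrobenius_inj _ p n)]
    exact hf'
  obtain ⟨A, b, hA, hcard, hb, hdisj⟩ := hK g hgirr hg'
  have hspec (a : K) : (g.map (evalRingHom a)).map (algebraMap K E) =
      (f.map (evalRingHom (algebraMap K E a))).map (iterateFrobenius E p n) := by
    have h := congrArg (Polynomial.map (evalRingHom (algebraMap K E a))) hg
    rw [Polynomial.map_map, Polynomial.map_map] at h
    rw [Polynomial.map_map, Polynomial.map_map]
    convert! h using 2
    · ext x <;> simp
    · ext x <;> simp [iterateFrobenius_def]
  have hsep (a : K) : (g.map (evalRingHom a)).Separable ↔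
      (f.map (evalRingHom (algebraMap K E a))).Separable := by
    rw [← separable_map (algebraMap K E), hspec, separable_map]
  have hfin : {a : K | ¬ (g.map (evalRingHom a)).Separable}.Finite := by
    refine ((finite_setOf_not_separable_map_eval hf hfΩ').preimage
      (algebraMap K Ω).injective.injOn).subset fun a ha ↦ ?_
    rw [Set.mem_ofPred_eq, hsep, ← separable_map (algebraMap E Ω)] at ha
    rw [Set.mem_preimage, Set.mem_ofPred_eq]
    convert! ha using 2
    rw [Polynomial.map_map, Polynomial.map_map, IsScalarTower.algebraMap_apply K E Ω]
    congr 1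
    ext x
    · simp [Ω]
    · simp
  let A₁ : Set K := {a ∈ A | (g.map (evalRingHom a)).Separable}
  have hA₁ : Cardinal.mk A₁ = Cardinal.mk K := by
    rcases finite_or_infinite K with h | h
    · have : A₁ = A := Set.sep_eq_self_iff_mem_true.2 fun a ha ↦
        PerfectField.separable_of_irreducible (hA ha)
      rw [this, hcard]
    · refine le_antisymm (Cardinal.mk_set_le _) ?_
      by_contra! hlt
      have h1 : Cardinal.mk A ≤ _ := (Cardinal.mk_le_mk_of_subset (t := A₁ ∪
        {a : K | ¬ (g.map (evalRingHom a)).Separable}) fun a ha ↦ by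
          by_cases h : (g.map (evalRingHom a)).Separable
          · exact Or.inl ⟨ha, h⟩
          · exact Or.inr h).trans (Cardinal.mk_union_le _ _)
      rw [hcard] at h1
      exact h1.not_gt (Cardinal.add_lt_of_lt (Cardinal.aleph0_le_mk K) hlt
        (hfin.lt_aleph0.trans_le (Cardinal.aleph0_le_mk K)))
  have hroot (a : A) : ∃ c : Ω, c ^ p ^ n = φ (b a) :=
    ⟨_, (iterateFrobeniusEquiv Ω p n).apply_symm_apply (φ (b a))⟩
  choose c hc using hroot
  have hc0 (a : A) : aeval (c a) (f.map (evalRingHom (algebraMap K E a))) = 0 := by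
    have h := congrArg (aeval (φ (b a))) (hspec a)
    rw [aeval_map_algebraMap, ← AlgEquiv.coe_toAlgHom, aeval_algHom_apply, hb, map_zero] at h
    have hcomp : (algebraMap E Ω).comp (iterateFrobenius E p n) =
        (iterateFrobenius Ω p n).comp (algebraMap E Ω) := by
      ext x
      simp [iterateFrobenius_def]
    refine iterateFrobenius_inj Ω p n ?_
    rw [map_zero, aeval_def, hom_eval₂, ← hcomp, iterateFrobenius_def, hc, ← eval₂_map,
      ← aeval_def]
    exact h.symm
  let e : algebraMap K E '' A₁ ≃ A₁ := (Equiv.Set.image _ A₁ (algebraMap K E).injective).symm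
  have he (a : algebraMap K E '' A₁) : algebraMap K E (e a) = a :=
    congrArg Subtype.val ((Equiv.Set.image _ A₁ (algebraMap K E).injective).apply_symm_apply a)
  let ι : algebraMap K E '' A₁ → A := fun a ↦ ⟨e a, (e a).2.1⟩
  have hι : Function.Injective ι := fun a a' h ↦ 
    e.injective (Subtype.ext (congrArg (fun x : A ↦ (x : K)) h))
  have hbsep (a : algebraMap K E '' A₁) : IsSeparable K (φ (b (ι a))) :=
    (isSeparable_map_iff φ.toAlgHom φ.injective).2 ((e a).2.2.of_dvd (minpoly.dvd K _ (hb (ι a))))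
  have hadj (a : algebraMap K E '' A₁) : E⟮c (ι a)⟯ = E⟮φ (b (ι a))⟯ := by
    have : IsSeparable E (c (ι a)) :=
      ((hsep _).1 (e a).2.2).of_dvd (minpoly.dvd E _ (hc0 (ι a)))
    rw [adjoin_simple_eq_adjoin_pow_expChar_pow_of_isSeparable E Ω this p n, hc]
  refine ⟨algebraMap K E '' A₁, fun a ↦ c (ι a), ?_, ?_, ?_, ?_⟩
  · rintro _ ⟨a, ha, rfl⟩
    refine irreducible_of_irreducible_map (iterateFrobenius E p n) ?_
    rw [← hspec]
    exact ha.2.map_irreducible_of_isPurelyInseparable E (hA ha.1)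
  · rw [Cardinal.mk_image_eq (algebraMap K E).injective, hA₁,
      Cardinal.mk_eq_of_isPurelyInseparable K E]
  · intro a
    rw [← he a]
    exact hc0 (ι a)
  · intro a
    rw [hadj]
    have h := (hdisj (ι a)).map φ.toAlgHom
    rw [adjoin_map, Set.image_singleton] at h
    refine LinearDisjoint.of_isPurelyInseparable (hbsep a) ?_ h
    refine iSup₂_le fun a' ha' ↦ ?_
    rw [hadj, adjoin_simple_le_iff]
    refine subset_adjoin E _ ⟨b (ι a'), ?_, rfl⟩
    have hle : K⟮b (ι a')⟯ ≤ ⨆ (a'' : A) (_ : a'' ≠ ι a), K⟮b a''⟯ :=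
      le_iSup₂_of_le (ι a') (hι.ne ha') le_rfl
    exact hle (mem_adjoin_simple_self K _)
end
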